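/- Let n ≥ 1 be an integer and let K be a nonempty compact subset of ℝⁿ. Let ℝⁿ/K denote the quotient topological space of ℝⁿ by the equivalence relation which identifies all points of K to one another and identifies no other points (with the quotient topology). Then the following are equivalent: (i) ℝⁿ/K is homeomorphic to ℝⁿ; (ii) every point of ℝⁿ/K has an open neighborhood homeomorphic to an open subset of ℝⁿ; (iii) K is cellular in ℝⁿ. -/

import Mathlib

/-- The setoid on `X` which identifies all points of `K` with one another and
identifies no other points. -/
def shrinkSetoid {X : Type*} (K : Set X) : Setoid X where
  r x y := x = y ∨ (x ∈ K ∧ y ∈ K)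
  iseqv := by
    refine ⟨fun x => Or.inl rfl, ?_, ?_⟩
    · intro x y hxy
      rcases hxy with rfl | ⟨hx, hy⟩
      · exact Or.inl rfl
      · exact Or.inr ⟨hy, hx⟩
    · intro x y z h1 h2
      rcases h1 with rfl | ⟨hx, hy⟩
      · exact h2
      · rcases h2 with rfl | ⟨hy', hz⟩
        · exact Or.inr ⟨hx, hy⟩
        · exact Or.inr ⟨hx, hz⟩

/-- `K ⊆ X` is cellular (with cells modeled on the closed unit ball of `ℝᵐ`) if it is
the intersection of a decreasing sequence of topological `m`-cells, each contained in
the interior of the previous one. -/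
def IsCellularIn (X : Type*) [TopologicalSpace X] (m : ℕ) (K : Set X) : Prop :=
  ∃ B : ℕ → Set X,
    (∀ i, Nonempty (↥(B i) ≃ₜ ↥(Metric.closedBall (0 : EuclideanSpace ℝ (Fin m)) 1))) ∧
    (∀ i, B (i + 1) ⊆ interior (B i)) ∧ K = ⋂ i, B i

section Helpers
open Set Filter Topology MeasureTheory Metric
open scoped NNReal ENNReal

section Brouwer
variable {E : Type*} [NormedAddCommGroup E] [InnerProductSpace ℝ E] [FiniteDimensional ℝ E]

lemma pert_homeo (U : E → E) (c : ℝ≥0) (hc : c < 1) (hU : LipschitzWith c U) :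
    ∃ h : E ≃ₜ E, ∀ x, h x = x + U x := by
  rcases subsingleton_or_nontrivial E with hE | hE
  · exact ⟨Homeomorph.refl E, fun x => Subsingleton.elim _ _⟩
  have hA : ApproximatesLinearOn (fun x => x + U x)
      ((ContinuousLinearEquiv.refl ℝ E : E ≃L[ℝ] E) : E →L[ℝ] E) univ c := by
    rw [ApproximatesLinearOn.approximatesLinearOn_iff_lipschitzOnWith]
    have : ((fun x => x + U x) - ⇑((ContinuousLinearEquiv.refl ℝ E : E ≃L[ℝ] E) : E →L[ℝ] E)) = U := by
      ext x; simp
    rw [this]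
    exact hU.lipschitzOnWith
  refine ⟨hA.toHomeomorph _ (Or.inr ?_), fun x => rfl⟩
  have : ‖(((ContinuousLinearEquiv.refl ℝ E).symm : E ≃L[ℝ] E) : E →L[ℝ] E)‖₊ = 1 := by
    have : ((((ContinuousLinearEquiv.refl ℝ E).symm : E ≃L[ℝ] E) : E →L[ℝ] E)) = ContinuousLinearMap.id ℝ E := rfl
    rw [this]
    exact ContinuousLinearMap.nnnorm_id
  rw [this]; simpa using hc

lemma det_interp (A : E →L[ℝ] E) (v : ℕ → ℝ) (hv : Function.Injective v) :
    (1 + A).det = ∑ k ∈ Finset.range (Module.finrank ℝ E + 1),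
      (Lagrange.basis (Finset.range (Module.finrank ℝ E + 1)) v k).eval 1 * (1 + v k • A).det := by
  classical
  let b := Module.finBasis ℝ E
  let M := LinearMap.toMatrix b b (A : E →ₗ[ℝ] E)
  let q : Polynomial ℝ := Matrix.det ((Polynomial.X : Polynomial ℝ) • M.map Polynomial.C + (1 : Matrix _ _ ℝ).map Polynomial.C)
  have hq : ∀ t : ℝ, q.eval t = (1 + t • A).det := by
    intro t
    have h1 : (1 + t • A).det = Matrix.det (1 + t • M) := by
      rw [ContinuousLinearMap.det, ← LinearMap.det_toMatrix b]
      congr 1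
      simp [M, LinearMap.toMatrix_one]
    rw [h1, ← Polynomial.coe_evalRingHom, RingHom.map_det]
    congr 1
    ext i j
    simp [Matrix.one_apply, add_comm]
    split_ifs <;> simp [mul_comm]
  have hdeg : q.degree < (Finset.range (Module.finrank ℝ E + 1)).card := by
    have := Polynomial.natDegree_det_X_add_C_le M 1
    rw [Finset.card_range]
    refine lt_of_le_of_lt Polynomial.degree_le_natDegree ?_
    have h2 : q.natDegree ≤ Module.finrank ℝ E := by simpa [q] using this
    exact_mod_cast Nat.lt_succ_of_le h2
  have := Lagrange.eq_interpolate (v := v) (f := q) hv.injOn hdeg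
  have h1 := hq 1
  rw [one_smul] at h1
  rw [← h1]
  conv_lhs => rw [this]
  rw [Lagrange.interpolate_apply, Polynomial.eval_finsetSum]
  refine Finset.sum_congr rfl fun k _ => ?_
  rw [Polynomial.eval_mul, Polynomial.eval_C, hq, mul_comm]


lemma no_retraction (r : E → E) (hr : ContDiff ℝ 1 r) (h1 : ∀ x, ‖r x‖ = 1)
    (h2 : ∀ x, ‖x‖ = 1 → r x = x) : False := by
  let _ : MeasurableSpace E := borel E
  have : BorelSpace E := ⟨rfl⟩
  let μ : Measure E := Measure.addHaar
  let D : Set E := closedBall 0 1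
  have hDc : IsCompact D := isCompact_closedBall 0 1
  let u : E → E := fun x => r x - x
  have hu : ContDiff ℝ 1 u := hr.sub contDiff_id
  let A : E → E →L[ℝ] E := fderiv ℝ u
  have hA : Continuous A := hu.continuous_fderiv one_ne_zero
  have huA : ∀ x, HasFDerivAt u (A x) x := fun x => (hu.differentiable one_ne_zero x).hasFDerivAt
  obtain ⟨L, hL⟩ : ∃ L : ℝ≥0, ∀ x ∈ D, ‖A x‖₊ ≤ L := by
    obtain ⟨C, hC⟩ := hDc.exists_bound_of_continuousOn hA.continuousOn
    refine ⟨C.toNNReal, fun x hx => ?_⟩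
    rw [← NNReal.coe_le_coe]
    exact (hC x hx).trans (Real.le_coe_toNNReal C)
  have huL : LipschitzOnWith L u D :=
    (convex_closedBall 0 1).lipschitzOnWith_of_nnnorm_hasFDerivWithin_le
      (fun x _ => (huA x).hasFDerivWithinAt) hL
  let U : E → E := fun x => if ‖x‖ ≤ 1 then u x else 0
  have hu0 : ∀ x, ‖x‖ = 1 → u x = 0 := fun x hx => by simp [u, h2 x hx]
  have key : ∀ x y : E, ‖x‖ ≤ 1 → ¬ ‖y‖ ≤ 1 → dist (U x) (U y) ≤ L * dist x y := by
    intro x y hx hy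
    obtain ⟨s, hs, hs1⟩ : ∃ s ∈ Icc (0:ℝ) 1, ‖x + s • (y - x)‖ = 1 := by
      have hc : ContinuousOn (fun s : ℝ => ‖x + s • (y - x)‖) (Icc 0 1) := by fun_prop
      have := intermediate_value_Icc (zero_le_one) hc
      have h := this (show (1:ℝ) ∈ _ by simp; exact ⟨hx, (not_le.1 hy).le⟩)
      exact h
    have e1 : U x = u x := if_pos hx
    have e2 : U y = 0 := if_neg hy
    rw [e1, e2, ← hu0 _ hs1]
    refine (huL.dist_le_mul x (by simpa [D] using hx) _ (by simpa [D] using hs1.le)).trans ?_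
    gcongr
    rw [dist_eq_norm, dist_eq_norm]
    have : x - (x + s • (y - x)) = s • (x - y) := by module
    rw [this, norm_smul, Real.norm_of_nonneg hs.1]
    exact mul_le_of_le_one_left (norm_nonneg _) hs.2
  have hU : LipschitzWith L U := by
    refine LipschitzWith.of_dist_le_mul fun x y => ?_
    by_cases hx : ‖x‖ ≤ 1 <;> by_cases hy : ‖y‖ ≤ 1
    · have e1 : U x = u x := if_pos hx
      have e2 : U y = u y := if_pos hy
      rw [e1, e2]
      exact huL.dist_le_mul x (by simpa [D] using hx) _ (by simpa [D] using hy)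
    · exact key x y hx hy
    · rw [dist_comm, dist_comm x]; exact key y x hy hx
    · have e1 : U x = 0 := if_neg hx
      have e2 : U y = 0 := if_neg hy
      rw [e1, e2, dist_self]; positivity
  have hdetc : Continuous fun p : ℝ × E => (1 + p.1 • A p.2).det :=
    ContinuousLinearMap.continuous_det.comp (by fun_prop)
  have hpos : ∀ᶠ t in 𝓝 (0:ℝ), ∀ x ∈ D, 0 < (1 + t • A x).det := by
    refine hDc.eventually_forall_of_forall_eventually fun x _ => ?_
    have : (0:ℝ) < (1 + (0:ℝ) • A x).det := by
      simp [ContinuousLinearMap.det]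
    exact hdetc.continuousAt.eventually (lt_mem_nhds this)
  have hLt : ∀ᶠ t : ℝ in 𝓝 (0:ℝ), t * (L:ℝ) < 1 := by
    have : Continuous fun t : ℝ => t * L := by fun_prop
    exact (this.continuousAt (x := 0)).eventually (gt_mem_nhds (by simp))
  have h1t : ∀ᶠ t in 𝓝 (0:ℝ), t < 1 := gt_mem_nhds one_pos
  obtain ⟨ε, hε, hε'⟩ := Metric.eventually_nhds_iff.1 (hpos.and (hLt.and h1t))
  have hvol : ∀ t : ℝ, 0 < t → t < ε → ∫ x in D, (1 + t • A x).det ∂μ = μ.real D := by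
    intro t ht0 htε
    obtain ⟨hp, hl, ht1⟩ := hε' (show dist t 0 < ε by simpa [abs_of_pos ht0] using htε)
    obtain ⟨h, hh⟩ := pert_homeo (fun x => t • U x) (t.toNNReal * L) (by
      rw [← NNReal.coe_lt_coe]; simpa [ht0.le] using hl) (by
      refine LipschitzWith.of_dist_le_mul fun x y => ?_
      rw [dist_smul₀, NNReal.coe_mul, Real.norm_of_nonneg ht0.le, Real.coe_toNNReal _ ht0.le, mul_assoc]
      gcongr
      exact hU.dist_le_mul x y)
    let f : E → E := fun x => x + t • u x
    have hf : ∀ x ∈ D, h x = f x := fun x hx => by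
      rw [hh]; simp only [f, U]; rw [if_pos (by simpa [D] using hx)]
    have hinj : InjOn f D := by
      intro x hx y hy hxy
      rw [← hf x hx, ← hf y hy] at hxy
      exact h.injective hxy
    have him : f '' D = D := by
      apply Subset.antisymm
      · rintro _ ⟨x, hx, rfl⟩
        have hx' : ‖x‖ ≤ 1 := by simpa [D] using hx
        have : f x = (1 - t) • x + t • r x := by simp only [f, u]; module
        rw [this]
        simp only [D, mem_closedBall, dist_zero_right]
        refine (norm_add_le _ _).trans ?_
        rw [norm_smul, norm_smul, h1, Real.norm_of_nonneg ht0.le, Real.norm_of_nonneg (by linarith)]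
        nlinarith
      · intro y hy
        obtain ⟨x, rfl⟩ := h.surjective y
        by_cases hx : ‖x‖ ≤ 1
        · exact ⟨x, by simpa [D] using hx, (hf x (by simpa [D] using hx)).symm⟩
        · exfalso
          have : h x = x := by rw [hh]; simp [U, hx]
          rw [this] at hy
          exact hx (by simpa [D] using hy)
    have hder : ∀ x ∈ D, HasFDerivWithinAt f (1 + t • A x) D x := fun x _ =>
      ((hasFDerivAt_id x).add ((huA x).const_smul t)).hasFDerivWithinAt
    have := integral_image_eq_integral_abs_det_fderiv_smul μ hDc.measurableSet hder hinj (fun _ => (1:ℝ))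
    rw [him] at this
    simp only [integral_const, smul_eq_mul, mul_one, measureReal_restrict_apply_univ] at this
    rw [this]
    refine setIntegral_congr_fun hDc.measurableSet fun x hx => ?_
    exact (abs_of_pos (hp x hx)).symm
  let v : ℕ → ℝ := fun k => ε / (k + 2)
  have hv : Function.Injective v := by
    intro a b hab
    simp only [v] at hab
    have ha : (0:ℝ) < a + 2 := by positivity
    have hb : (0:ℝ) < b + 2 := by positivity
    field_simp at hab
    have : (a:ℝ) = b := by linarith
    exact_mod_cast this
  have hv0 : ∀ k, 0 < v k := fun k => by simp only [v]; positivity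
  have hvε : ∀ k, v k < ε := fun k => by
    simp only [v]
    rw [div_lt_iff₀ (by positivity)]
    have : (0:ℝ) ≤ k := by positivity
    nlinarith
  have hz : ∀ x, (1 + A x).det = 0 := by
    intro x
    have hrx : HasFDerivAt r (1 + A x) x := by
      have := (hasFDerivAt_id x).add (huA x)
      refine this.congr_of_eventuallyEq (Eventually.of_forall fun y => ?_)
      simp [u]
    by_contra hne
    have hsurj : Function.Surjective ((1 + A x : E →L[ℝ] E) : E →ₗ[ℝ] E) := by
      have : IsUnit (((1 + A x : E →L[ℝ] E) : E →ₗ[ℝ] E)) := by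
        rw [LinearMap.isUnit_iff_isUnit_det]; exact isUnit_iff_ne_zero.2 hne
      exact ((Module.End.isUnit_iff _).1 this).2
    obtain ⟨w, hw⟩ := hsurj (r x)
    have hd := hrx.inner ℝ hrx
    have hc : (fun t => inner ℝ (r t) (r t)) = fun _ : E => (1:ℝ) := by
      ext y; rw [real_inner_self_eq_norm_sq, h1]; norm_num
    rw [hc] at hd
    have := hd.unique (hasFDerivAt_const (1:ℝ) x)
    have := congrArg (fun l : E →L[ℝ] ℝ => l w) this
    have hw' : (1 + A x) w = r x := hw
    simp only [ContinuousLinearMap.comp_apply, ContinuousLinearMap.prod_apply,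
      fderivInnerCLM_apply, hw', real_inner_self_eq_norm_sq, h1] at this
    norm_num at this
  have hint : ∀ t : ℝ, IntegrableOn (fun x => (1 + t • A x).det) D μ := fun t =>
    ((hdetc.comp (Continuous.prodMk_right t)).continuousOn).integrableOn_compact hDc
  have hfin : (0:ℝ) = μ.real D := by
    calc (0:ℝ) = ∫ x in D, (1 + A x).det ∂μ := by simp [hz]
      _ = ∫ x in D, ∑ k ∈ Finset.range (Module.finrank ℝ E + 1),
        (Lagrange.basis (Finset.range (Module.finrank ℝ E + 1)) v k).eval 1 * (1 + v k • A x).det ∂μ := by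
          congr 1; ext x; exact det_interp (A x) v hv
      _ = ∑ k ∈ Finset.range (Module.finrank ℝ E + 1),
        (Lagrange.basis (Finset.range (Module.finrank ℝ E + 1)) v k).eval 1 * μ.real D := by
          rw [integral_finsetSum _ fun k _ => (hint (v k)).const_mul _]
          refine Finset.sum_congr rfl fun k _ => ?_
          rw [integral_const_mul, hvol _ (hv0 k) (hvε k)]
      _ = μ.real D := by
          rw [← Finset.sum_mul, ← Polynomial.eval_finsetSum, Lagrange.sum_basis hv.injOn (by simp)]
          simp
  have : 0 < μ D := measure_closedBall_pos μ 0 one_pos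
  have h' : 0 < μ.real D := ENNReal.toReal_pos this.ne' hDc.measure_lt_top.ne
  linarith


lemma exists_zero_of_id_outside (G : E → E) (hG : Continuous G)
    (h1 : ∀ x, 1 / 2 ≤ ‖x‖ → G x = x) : ∃ x, G x = 0 := by
  by_contra! hne
  have hU : {x : E | 1 / 2 < ‖x‖} ∈ 𝓝ˢ {x : E | 1 ≤ ‖x‖} := by
    refine (isOpen_lt continuous_const continuous_norm).mem_nhdsSet.2 fun x hx => ?_
    simp only [mem_ofPred_eq] at *; linarith
  obtain ⟨g, hg, hd, he, -⟩ := hG.exists_contDiff_approx_and_eqOn 1 (ε := fun x => ‖G x‖)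
    hG.norm (fun x => norm_pos_iff.2 (hne x)) (isClosed_le continuous_const continuous_norm) hU
    (contDiff_id.contDiffOn.congr fun x hx => h1 x (le_of_lt hx))
  have hg0 : ∀ x, g x ≠ 0 := by
    intro x hx
    have := hd x
    rw [hx, dist_zero_left] at this
    exact lt_irrefl _ this
  refine no_retraction (fun x => ‖g x‖⁻¹ • g x) ?_ ?_ ?_
  · exact ((hg.norm ℝ hg0).inv (fun x => norm_ne_zero_iff.2 (hg0 x))).smul hg
  · intro x
    rw [norm_smul, norm_inv, norm_norm, inv_mul_cancel₀ (norm_ne_zero_iff.2 (hg0 x))]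
  · intro x hx
    have : g x = x := by rw [he (show 1 ≤ ‖x‖ from hx.ge), h1 x (by rw [hx]; norm_num)]
    simp [this, hx]

lemma brouwer_fixed (F : E → E) (hF : ContinuousOn F (closedBall 0 1))
    (hm : ∀ x, ‖x‖ ≤ 1 → ‖F x‖ ≤ 1) : ∃ x, ‖x‖ ≤ 1 ∧ F x = x := by
  let P : E → E := fun x => (max 1 ‖x‖)⁻¹ • x
  have hpos : ∀ x : E, 0 < max 1 ‖x‖ := fun x => lt_of_lt_of_le one_pos (le_max_left _ _)
  have hP : Continuous P :=
    ((continuous_const.max continuous_norm).inv₀ fun x => (hpos x).ne').smul continuous_id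
  have hPD : ∀ x, ‖P x‖ ≤ 1 := by
    intro x
    simp only [P]
    rw [norm_smul, norm_inv, Real.norm_of_nonneg (hpos x).le, inv_mul_le_iff₀ (hpos x), mul_one]
    exact le_max_right _ _
  have hPid : ∀ x, ‖x‖ ≤ 1 → P x = x := fun x hx => by simp [P, max_eq_left hx]
  let φ : ℝ → ℝ := fun t => max 0 (min 1 (2 - t))
  have hφ : Continuous φ := by fun_prop
  have hFP : Continuous fun x => F (P x) :=
    hF.comp_continuous hP fun x => by simpa using hPD x
  let G : E → E := fun x => x - φ ‖x‖ • F (P x)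
  have hG : Continuous G := continuous_id.sub ((hφ.comp continuous_norm).smul hFP)
  obtain ⟨x, hx⟩ := exists_zero_of_id_outside (fun x => (1 / 4 : ℝ) • G ((4:ℝ) • x))
    (by fun_prop) (by
      intro x hx
      have h4 : ‖(4:ℝ) • x‖ = 4 * ‖x‖ := by rw [norm_smul]; norm_num
      have : φ ‖(4:ℝ) • x‖ = 0 := by
        rw [h4]; simp only [φ]
        exact max_eq_left ((min_le_right _ _).trans (by linarith))
      simp only [G]
      rw [this, zero_smul, sub_zero, smul_smul]; norm_num)
  have hy : G ((4:ℝ) • x) = 0 := by simpa using hx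
  set y := (4:ℝ) • x
  have hyF : y = φ ‖y‖ • F (P y) := sub_eq_zero.1 hy
  have hφ0 : 0 ≤ φ ‖y‖ := le_max_left _ _
  have hle : ‖y‖ ≤ φ ‖y‖ := by
    conv_lhs => rw [hyF]
    rw [norm_smul, Real.norm_of_nonneg hφ0]
    exact mul_le_of_le_one_right hφ0 (hm _ (hPD y))
  have hy1 : ‖y‖ ≤ 1 := hle.trans (max_le zero_le_one (min_le_left _ _))
  refine ⟨y, hy1, ?_⟩
  have hφ1 : φ ‖y‖ = 1 := by
    simp only [φ]; rw [min_eq_left (by linarith)]; simp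
  rw [hφ1, one_smul, hPid y hy1] at hyF
  exact hyF.symm

lemma invariance_zero [Nontrivial E] (f : E → E) (hf : ContinuousOn f (closedBall 0 1))
    (hi : InjOn f (closedBall 0 1)) : f '' (closedBall 0 1) ∈ 𝓝 (f 0) := by
  by_contra hnot
  let _ : MeasurableSpace E := borel E
  have : BorelSpace E := ⟨rfl⟩
  let μ : Measure E := Measure.addHaar
  let D : Set E := closedBall 0 1
  have hDc : IsCompact D := isCompact_closedBall 0 1
  have h0D : (0:E) ∈ D := by simp [D]
  have hfD : IsCompact (f '' D) := hDc.image_of_continuousOn hf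
  obtain ⟨G, hG, hGf⟩ : ∃ G : E → E, Continuous G ∧ ∀ x ∈ D, G (f x) = x := by
    have : CompactSpace D := isCompact_iff_compactSpace.1 hDc
    have hemb : IsClosedEmbedding (D.domRestrict f) :=
      (continuousOn_iff_continuous_domRestrict.1 hf).isClosedEmbedding (injOn_iff_injective.1 hi)
    obtain ⟨g, hg⟩ := ContinuousMap.exists_extension' hemb (⟨Subtype.val, continuous_subtype_val⟩ : C(D, E))
    refine ⟨g, g.continuous, fun x hx => ?_⟩
    exact congrFun hg ⟨x, hx⟩
  have hG0 : G (f 0) = 0 := hGf 0 h0D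
  obtain ⟨ε2, hε2, hGε⟩ := Metric.continuousAt_iff.1 (hG.continuousAt (x := f 0)) (1/10) (by norm_num)
  rw [hG0] at hGε
  simp only [dist_zero_right] at hGε
  obtain ⟨ε, hε, hεε⟩ : ∃ ε, 0 < ε ∧ 3 * ε = ε2 := ⟨ε2 / 3, by positivity, by ring⟩
  obtain ⟨c, hc, hcf⟩ : ∃ c, dist c (f 0) < ε ∧ c ∉ f '' D := by
    by_contra! hcon
    exact hnot (Filter.mem_of_superset (Metric.ball_mem_nhds _ hε) fun c hc => hcon c hc)
  let S1 : Set E := f '' D \ ball c ε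
  have hS1 : IsCompact S1 := hfD.diff isOpen_ball
  have hGS1 : ∀ y ∈ S1, G y ≠ 0 := by
    rintro _ ⟨⟨x, hx, rfl⟩, hy⟩ h
    rw [hGf x hx] at h
    subst h
    exact hy (by rw [mem_ball, dist_comm]; exact hc)
  obtain ⟨δ, hδ, hδ1, hδG⟩ : ∃ δ > 0, δ ≤ 1/10 ∧ ∀ y ∈ S1, δ ≤ ‖G y‖ := by
    rcases S1.eq_empty_or_nonempty with he | hne
    · exact ⟨1/10, by norm_num, le_rfl, by simp [he]⟩
    · obtain ⟨y, hy, hmin⟩ := hS1.exists_isMinOn hne (f := fun y => ‖G y‖) hG.norm.continuousOn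
      refine ⟨min (1/10) ‖G y‖, lt_min (by norm_num) (norm_pos_iff.2 (hGS1 y hy)), min_le_left _ _,
        fun z hz => (min_le_right _ _).trans (hmin hz)⟩
  obtain ⟨P, hP, hPG, -⟩ := hG.exists_contDiff_approx 1 (ε := fun _ => δ / 4) continuous_const
    (fun _ => by positivity)
  have hnull : μ (P '' sphere c ε) = 0 :=
    addHaar_image_eq_zero_of_differentiableOn_of_addHaar_eq_zero μ
      (hP.differentiable (by norm_num)).differentiableOn (Measure.addHaar_sphere μ c ε)
  obtain ⟨v, hv, hvP⟩ : ∃ v : E, ‖v‖ < δ / 4 ∧ v ∉ P '' sphere c ε := by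
    by_contra! hcon
    have h1 : ball (0:E) (δ/4) ⊆ P '' sphere c ε := fun v hv => hcon v (by simpa using hv)
    have h2 := measure_mono (μ := μ) h1
    rw [hnull] at h2
    exact (measure_ball_pos μ (0:E) (by positivity : 0 < δ/4)).ne' (le_antisymm h2 bot_le)
  have hPG' : ∀ y, ‖P y - v - G y‖ < δ / 2 := by
    intro y
    have := hPG y
    rw [dist_eq_norm] at this
    calc ‖P y - v - G y‖ = ‖(P y - G y) - v‖ := by congr 1; abel
      _ ≤ ‖P y - G y‖ + ‖v‖ := norm_sub_le _ _
      _ < δ / 2 := by linarith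
  let ρ : E → E := fun y => c + (max (ε / ‖y - c‖) 1) • (y - c)
  have hyc : ∀ y ∈ f '' D, y - c ≠ 0 := fun y hy h => hcf (by rw [sub_eq_zero] at h; rwa [← h])
  have hρ : ContinuousOn ρ (f '' D) := by
    have : ContinuousOn (fun y => ε / ‖y - c‖) (f '' D) :=
      continuousOn_const.div (by fun_prop) fun y hy => norm_ne_zero_iff.2 (hyc y hy)
    have h2 : ContinuousOn (fun y => max (ε / ‖y - c‖) 1) (f '' D) :=
      ContinuousOn.sup this continuousOn_const
    exact continuousOn_const.add (h2.smul (by fun_prop))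
  have hρ1 : ∀ y ∈ f '' D, ε ≤ ‖y - c‖ → ρ y = y := by
    intro y hy h
    have : ε / ‖y - c‖ ≤ 1 := (div_le_one (norm_pos_iff.2 (hyc y hy))).2 h
    simp [ρ, max_eq_right this]
  have hρ2 : ∀ y ∈ f '' D, ‖y - c‖ ≤ ε → ρ y ∈ sphere c ε := by
    intro y hy h
    have hp := norm_pos_iff.2 (hyc y hy)
    have : 1 ≤ ε / ‖y - c‖ := (one_le_div hp).2 h
    simp only [ρ, max_eq_left this, mem_sphere, dist_eq_norm, add_sub_cancel_left]
    rw [norm_smul, Real.norm_of_nonneg (by positivity), div_mul_cancel₀ _ hp.ne']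
  have hnz : ∀ y ∈ f '' D, P (ρ y) - v ≠ 0 ∧ ‖P (ρ y) - v - G y‖ ≤ 1 := by
    intro y hy
    rcases le_total ε ‖y - c‖ with h | h
    · rw [hρ1 y hy h]
      refine ⟨fun h0 => ?_, (hPG' y).le.trans (by linarith)⟩
      have h1 := hPG' y
      rw [h0, zero_sub, norm_neg] at h1
      have := hδG y ⟨hy, by simpa [dist_eq_norm] using h⟩
      linarith
    · have hs := hρ2 y hy h
      refine ⟨fun h0 => hvP ⟨ρ y, hs, sub_eq_zero.1 h0⟩, ?_⟩
      have h1 : ‖G (ρ y)‖ < 1/10 := by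
        apply hGε
        have := dist_triangle (ρ y) c (f 0)
        rw [mem_sphere.1 hs] at this
        linarith
      have h2 : ‖G y‖ < 1/10 := by
        apply hGε
        have := dist_triangle y c (f 0)
        rw [dist_eq_norm y c] at this
        linarith
      have h3 := hPG' (ρ y)
      calc ‖P (ρ y) - v - G y‖ = ‖(P (ρ y) - v - G (ρ y)) + (G (ρ y) - G y)‖ := by congr 1; abel
        _ ≤ ‖P (ρ y) - v - G (ρ y)‖ + (‖G (ρ y)‖ + ‖G y‖) :=
          (norm_add_le _ _).trans (by gcongr; exact norm_sub_le _ _)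
        _ ≤ 1 := by linarith
  obtain ⟨x, hx, hfix⟩ := brouwer_fixed (fun x => x - (P (ρ (f x)) - v)) (by
      refine continuousOn_id.sub (ContinuousOn.sub ?_ continuousOn_const)
      exact hP.continuous.comp_continuousOn (hρ.comp hf (mapsTo_image f D))) (by
      intro x hx
      have hxD : x ∈ D := by simpa [D] using hx
      have := (hnz (f x) (mem_image_of_mem f hxD)).2
      rw [hGf x hxD] at this
      rw [← norm_neg]; simpa using this)
  have hxD : x ∈ D := by simpa [D] using hx
  exact (hnz (f x) (mem_image_of_mem f hxD)).1 (by simpa using hfix)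

theorem invariance_of_domain [Nontrivial E] {f : E → E} {O : Set E} (hO : IsOpen O)
    (hf : ContinuousOn f O) (hi : InjOn f O) : IsOpen (f '' O) := by
  rw [isOpen_iff_mem_nhds]
  rintro _ ⟨x, hx, rfl⟩
  obtain ⟨ε, hε, hsub⟩ := Metric.nhds_basis_closedBall.mem_iff.1 (hO.mem_nhds hx)
  have hmaps : MapsTo (fun z : E => x + ε • z) (closedBall 0 1) (closedBall x ε) := by
    intro z hz
    simp only [mem_closedBall, dist_eq_norm, add_sub_cancel_left, sub_zero] at *
    rw [norm_smul, Real.norm_of_nonneg hε.le]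
    exact mul_le_of_le_one_right hε.le hz
  have := invariance_zero (fun z => f (x + ε • z))
    ((hf.mono hsub).comp (by fun_prop) hmaps) (by
      intro a ha b hb hab
      have := hi (hsub (hmaps ha)) (hsub (hmaps hb)) hab
      have h2 : ε • a = ε • b := by simpa using this
      exact smul_right_injective E hε.ne' h2)
  simp only [smul_zero, add_zero] at this
  refine Filter.mem_of_superset this ?_
  rintro _ ⟨z, hz, rfl⟩
  exact ⟨_, hsub (hmaps hz), rfl⟩


end Brouwer

section Squeeze
variable {E : Type*} [NormedAddCommGroup E] [InnerProductSpace ℝ E] [FiniteDimensional ℝ E]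

lemma power_bij (m : ℕ) : BijOn (fun z : E => ‖z‖ ^ m • z) (closedBall 0 1) (closedBall 0 1) := by
  have hn : ∀ z : E, ‖‖z‖ ^ m • z‖ = ‖z‖ ^ (m + 1) := fun z => by
    rw [norm_smul, norm_pow, norm_norm, pow_succ]
  refine ⟨?_, ?_, ?_⟩
  · intro z hz
    simp only [mem_closedBall, dist_zero_right] at *
    rw [hn]
    exact pow_le_one₀ (norm_nonneg _) hz
  · intro a _ b _ hab
    simp only at hab
    have h1 : ‖a‖ = ‖b‖ := by
      have := congrArg norm hab
      rw [hn, hn] at this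
      exact (pow_left_inj₀ (norm_nonneg _) (norm_nonneg _) (by omega)).1 this
    rcases eq_or_ne b 0 with hb | hb
    · rw [hb, norm_zero] at h1
      rw [hb, norm_eq_zero.1 h1]
    · rw [h1] at hab
      exact smul_right_injective E (pow_ne_zero m (norm_ne_zero_iff.2 hb)) hab
  · intro w hw
    rcases eq_or_ne w 0 with h | h
    · exact ⟨0, by simp, by simp [h]⟩
    · have hw' : ‖w‖ ≤ 1 := by simpa using hw
      have hp := norm_pos_iff.2 h
      obtain ⟨t, ht, htw⟩ : ∃ t ∈ Icc (0:ℝ) 1, t ^ (m + 1) = ‖w‖ := by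
        have hc : ContinuousOn (fun t : ℝ => t ^ (m + 1)) (Icc 0 1) := by fun_prop
        have := intermediate_value_Icc zero_le_one hc
        exact this (by simpa using hw')
      have hz : ‖(t / ‖w‖) • w‖ = t := by
        rw [norm_smul, Real.norm_of_nonneg (div_nonneg ht.1 hp.le), div_mul_cancel₀ _ hp.ne']
      refine ⟨(t / ‖w‖) • w, by simpa [hz] using ht.2, ?_⟩
      simp only [hz]
      rw [smul_smul, ← mul_div_assoc, ← pow_succ, htw, div_self hp.ne', one_smul]

lemma squeeze_step [Nontrivial E] {B C : Set E} (e : B ≃ₜ closedBall (0:E) 1) (hC : IsCompact C)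
    (hCB : C ⊆ interior B) (H : C(E, E)) (ε : ℝ) (hε : 0 < ε) :
    ∃ s : C(E, E), Function.Bijective s ∧ (∀ x, x ∉ B → s x = x) ∧ (∀ x ∈ B, s x ∈ B) ∧
      ∀ x ∈ C, ∀ y ∈ C, dist (H (s x)) (H (s y)) ≤ ε := by
  classical
  let D : Set E := closedBall 0 1
  have hDc : IsCompact D := isCompact_closedBall 0 1
  have hBc : IsCompact B := by
    have : CompactSpace (closedBall (0:E) 1) := isCompact_iff_compactSpace.1 hDc
    have : CompactSpace B := e.symm.compactSpace
    exact isCompact_iff_compactSpace.2 this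
  let β : E → E := fun z => if h : z ∈ D then (e.symm ⟨z, h⟩ : E) else 0
  let γ : E → E := fun x => if h : x ∈ B then (e ⟨x, h⟩ : E) else 0
  have hβe : ∀ z (h : z ∈ D), β z = e.symm ⟨z, h⟩ := fun z h => dif_pos h
  have hγe : ∀ x (h : x ∈ B), γ x = e ⟨x, h⟩ := fun x h => dif_pos h
  have hβc : ContinuousOn β D := by
    rw [continuousOn_iff_continuous_domRestrict]
    have : D.domRestrict β = fun z => (e.symm z : E) := by
      ext z; exact hβe z z.2
    rw [this]
    exact continuous_subtype_val.comp e.symm.continuous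
  have hγc : ContinuousOn γ B := by
    rw [continuousOn_iff_continuous_domRestrict]
    have : B.domRestrict γ = fun z => (e z : E) := by
      ext z; exact hγe z z.2
    rw [this]
    exact continuous_subtype_val.comp e.continuous
  have hβB : ∀ z ∈ D, β z ∈ B := fun z h => by rw [hβe z h]; exact Subtype.coe_prop _
  have hγD : ∀ x ∈ B, γ x ∈ D := fun x h => by rw [hγe x h]; exact Subtype.coe_prop _
  have hβγ : ∀ x ∈ B, β (γ x) = x := fun x h => by
    rw [hβe _ (hγD x h)]
    have : (⟨γ x, hγD x h⟩ : closedBall (0:E) 1) = e ⟨x, h⟩ := Subtype.ext (hγe x h)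
    rw [this, e.symm_apply_apply]
  have hγβ : ∀ z ∈ D, γ (β z) = z := fun z h => by
    rw [hγe _ (hβB z h)]
    have : (⟨β z, hβB z h⟩ : B) = e.symm ⟨z, h⟩ := Subtype.ext (hβe z h)
    rw [this, e.apply_symm_apply]
  have hβi : InjOn β D := fun a ha b hb hab => by rw [← hγβ a ha, ← hγβ b hb, hab]
  have hγi : InjOn γ B := fun a ha b hb hab => by rw [← hβγ a ha, ← hβγ b hb, hab]
  have h_a : ∀ z ∈ ball (0:E) 1, β z ∈ interior B := by
    intro z hz
    have ho : IsOpen (β '' ball 0 1) := invariance_of_domain isOpen_ball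
      (hβc.mono ball_subset_closedBall) (hβi.mono ball_subset_closedBall)
    refine interior_maximal ?_ ho (mem_image_of_mem β hz)
    rintro _ ⟨w, hw, rfl⟩
    exact hβB w (ball_subset_closedBall hw)
  have h_b : ∀ x ∈ interior B, γ x ∈ ball (0:E) 1 := by
    intro x hx
    have ho : IsOpen (γ '' interior B) := invariance_of_domain isOpen_interior
      (hγc.mono interior_subset) (hγi.mono interior_subset)
    have : γ '' interior B ⊆ interior D := by
      refine interior_maximal ?_ ho
      rintro _ ⟨w, hw, rfl⟩
      exact hγD w (interior_subset hw)
    have h2 := this (mem_image_of_mem γ hx)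
    rwa [interior_closedBall _ one_ne_zero] at h2
  obtain ⟨r, hr0, hr1, hr⟩ : ∃ r : ℝ, 0 ≤ r ∧ r < 1 ∧ ∀ x ∈ C, ‖γ x‖ ≤ r := by
    rcases C.eq_empty_or_nonempty with he | hne
    · exact ⟨0, le_rfl, one_pos, by simp [he]⟩
    · obtain ⟨y, hy, hmax⟩ := hC.exists_isMaxOn hne (f := fun y => ‖γ y‖)
        (hγc.mono (hCB.trans interior_subset)).norm
      exact ⟨‖γ y‖, norm_nonneg _, by simpa using h_b y (hCB hy), fun z hz => hmax hz⟩
  have hHβ : ContinuousAt (fun z => H (β z)) 0 :=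
    (H.continuous.comp_continuousOn hβc).continuousAt (closedBall_mem_nhds 0 one_pos)
  obtain ⟨η, hη, hηH⟩ := Metric.continuousAt_iff.1 hHβ (ε / 2) (by positivity)
  obtain ⟨m, hm⟩ := exists_pow_lt_of_lt_one hη hr1
  let σ : E → E := fun z => ‖z‖ ^ m • z
  have hσ : BijOn σ D D := power_bij m
  have hσc : Continuous σ := by fun_prop
  let f : E → E := fun x => β (σ (γ x))
  have hfB : BijOn f B B :=
    (show BijOn β D B from ⟨hβB, hβi, fun x hx => ⟨γ x, hγD x hx, hβγ x hx⟩⟩).comp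
      (hσ.comp (show BijOn γ B D from ⟨hγD, hγi, fun x hx => ⟨β x, hβB x hx, hγβ x hx⟩⟩))
  let s : E → E := B.piecewise f id
  have hs1 : ∀ x ∈ B, s x = f x := fun x hx => piecewise_eq_of_mem _ _ _ hx
  have hs2 : ∀ x, x ∉ B → s x = x := fun x hx => piecewise_eq_of_notMem _ _ _ hx
  have hsc : Continuous s := by
    apply continuous_piecewise
    · intro a ha
      have haB : a ∈ B := hBc.isClosed.frontier_subset ha
      have hai : a ∉ interior B := ha.2
      have h1 : ‖γ a‖ = 1 := by
        by_contra hne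
        apply hai
        rw [← hβγ a haB]
        apply h_a
        have h2 : ‖γ a‖ ≤ 1 := by simpa [D] using hγD a haB
        simpa using lt_of_le_of_ne h2 hne
      simp only [f, σ, h1, one_pow, one_smul, id]
      exact hβγ a haB
    · rw [hBc.isClosed.closure_eq]
      exact hβc.comp (hσc.comp_continuousOn hγc) fun x hx => hσ.mapsTo (hγD x hx)
    · exact continuousOn_id
  refine ⟨⟨s, hsc⟩, ⟨?_, ?_⟩, hs2, fun x hx => ?_, ?_⟩
  · intro x y hxy
    simp only [ContinuousMap.coe_mk] at hxy
    by_cases hx : x ∈ B <;> by_cases hy : y ∈ B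
    · rw [hs1 x hx, hs1 y hy] at hxy
      exact hfB.injOn hx hy hxy
    · rw [hs1 x hx, hs2 y hy] at hxy
      exact absurd (hxy ▸ hfB.mapsTo hx) hy
    · rw [hs2 x hx, hs1 y hy] at hxy
      exact absurd (hxy ▸ hfB.mapsTo hy) hx
    · rwa [hs2 x hx, hs2 y hy] at hxy
  · intro y
    by_cases hy : y ∈ B
    · obtain ⟨x, hx, rfl⟩ := hfB.surjOn hy
      exact ⟨x, hs1 x hx⟩
    · exact ⟨y, hs2 y hy⟩
  · change s x ∈ B
    rw [hs1 x hx]; exact hfB.mapsTo hx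
  · have hsm : ∀ x ∈ C, dist (H (s x)) (H (β 0)) < ε / 2 := by
      intro x hx
      rw [hs1 x (interior_subset (hCB hx))]
      apply hηH
      simp only [σ, dist_zero_right]
      rw [norm_smul, norm_pow, norm_norm]
      have h1 := hr x hx
      calc ‖γ x‖ ^ m * ‖γ x‖ ≤ r ^ m * 1 := by
            gcongr; exact h1.trans hr1.le
        _ < η := by simpa using hm
    intro x hx y hy
    have h1 := hsm x hx
    have h2 := hsm y hy
    exact (dist_triangle_right _ _ (H (β 0))).trans (by
      change dist (H (s x)) _ + dist (H (s y)) _ ≤ _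
      linarith)

lemma collapse_exists [Nontrivial E] (B : ℕ → Set E) (hB : ∀ i, Nonempty (B i ≃ₜ closedBall (0:E) 1))
    (hBi : ∀ i, B (i + 1) ⊆ interior (B i)) (hne : (⋂ i, B i).Nonempty) :
    ∃ f : E → E, Continuous f ∧ Function.Surjective f ∧ (∀ x, x ∉ B 0 → f x = x) ∧
      ∀ x y, f x = f y ↔ x = y ∨ (x ∈ (⋂ i, B i) ∧ y ∈ (⋂ i, B i)) := by
  have hBc : ∀ i, IsCompact (B i) := fun i => by
    have : CompactSpace (closedBall (0:E) 1) := isCompact_iff_compactSpace.1 (isCompact_closedBall 0 1)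
    have : CompactSpace (B i) := (hB i).some.symm.compactSpace
    exact isCompact_iff_compactSpace.2 this
  have hanti : Antitone B := antitone_nat_of_succ_le fun i => (hBi i).trans interior_subset
  choose s hsb hs1 hs2 hs3 using fun (i : ℕ) (H : C(E, E)) =>
    squeeze_step (hB i).some (hBc (i + 1)) (hBi i) H ((1 / 2 : ℝ) ^ i) (by positivity)
  let H : ℕ → C(E, E) := fun i => Nat.rec (ContinuousMap.id E) (fun i H => H.comp (s i H)) i
  have hH0 : ∀ x, H 0 x = x := fun x => rfl
  have hHs : ∀ i x, H (i + 1) x = H i (s i (H i) x) := fun i x => rfl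
  have hHb : ∀ i, Function.Bijective (H i) := by
    intro i
    induction i with
    | zero => exact Function.bijective_id
    | succ i ih => exact ih.comp (hsb i (H i))
  have hout : ∀ i j, i ≤ j → ∀ x, x ∉ B i → H j x = H i x := by
    intro i j hij
    induction j, hij using Nat.le_induction with
    | base => intros; rfl
    | succ j hj ih =>
      intro x hx
      rw [hHs, hs1 j (H j) x fun h => hx (hanti hj h), ih x hx]
  have hin : ∀ i j, i ≤ j → ∀ x ∈ B i, H j x ∈ H i '' B i := by
    intro i j hij
    induction j, hij using Nat.le_induction with
    | base => intro x hx; exact ⟨x, hx, rfl⟩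
    | succ j hj ih =>
      intro x hx
      rw [hHs]
      apply ih
      by_cases h : x ∈ B j
      · exact hanti hj (hs2 j (H j) x h)
      · rw [hs1 j (H j) x h]; exact hx
  have hdiam : ∀ i, ∀ p ∈ H (i + 1) '' B (i + 1), ∀ q ∈ H (i + 1) '' B (i + 1),
      dist p q ≤ (1 / 2 : ℝ) ^ i := by
    rintro i _ ⟨x, hx, rfl⟩ _ ⟨y, hy, rfl⟩
    exact hs3 i (H i) x hx y hy
  have hd : ∀ i j, i + 1 ≤ j → ∀ x, dist (H j x) (H (i + 1) x) ≤ (1 / 2 : ℝ) ^ i := by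
    intro i j hij x
    by_cases h : x ∈ B (i + 1)
    · exact hdiam i _ (hin _ _ hij x h) _ ⟨x, h, rfl⟩
    · rw [hout _ _ hij x h, dist_self]; positivity
  have hpow : Tendsto (fun i : ℕ => (1 / 2 : ℝ) ^ i) atTop (𝓝 0) :=
    tendsto_pow_atTop_nhds_zero_of_lt_one (by norm_num) (by norm_num)
  have hlim : ∀ x, ∃ y, Tendsto (fun i => H i x) atTop (𝓝 y) := by
    intro x
    apply cauchySeq_tendsto_of_complete
    refine (cauchySeq_shift 1).1 ?_
    rw [Metric.cauchySeq_iff']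
    intro ε hε
    obtain ⟨N, hN⟩ := (hpow.eventually (gt_mem_nhds hε)).exists
    exact ⟨N, fun j hj => (hd N (j + 1) (by omega) x).trans_lt hN⟩
  choose f hf using hlim
  have hfd : ∀ i x, dist (f x) (H (i + 1) x) ≤ (1 / 2 : ℝ) ^ i := by
    intro i x
    refine le_of_tendsto ((hf x).dist tendsto_const_nhds) ?_
    filter_upwards [eventually_ge_atTop (i + 1)] with j hj using hd i j hj x
  have hfout : ∀ i x, x ∉ B i → f x = H i x := fun i x hx =>
    tendsto_nhds_unique (hf x) (tendsto_const_nhds.congr' (by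
      filter_upwards [eventually_ge_atTop i] with j hj using (hout i j hj x hx).symm))
  have hfin : ∀ i, ∀ x ∈ B i, f x ∈ H i '' B i := fun i x hx =>
    ((hBc i).image (H i).continuous).isClosed.mem_of_tendsto (hf x) (by
      filter_upwards [eventually_ge_atTop i] with j hj using hin i j hj x hx)
  have hfc : Continuous f := by
    have : TendstoUniformly (fun i x => H (i + 1) x) f atTop := by
      rw [Metric.tendstoUniformly_iff]
      intro ε hε
      filter_upwards [hpow.eventually (gt_mem_nhds hε)] with i hi x
      exact (hfd i x).trans_lt hi
    exact this.continuous (Frequently.of_forall fun i => (H (i + 1)).continuous)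
  have huniq : ∀ p q, (∀ i, p ∈ H i '' B i) → (∀ i, q ∈ H i '' B i) → p = q := by
    intro p q hp hq
    have : dist p q ≤ 0 := ge_of_tendsto' hpow fun i => hdiam i p (hp _) q (hq _)
    exact dist_le_zero.1 this
  have hK : ∀ x, x ∈ (⋂ i, B i) → ∀ i, f x ∈ H i '' B i := fun x hx i =>
    hfin i x (mem_iInter.1 hx i)
  obtain ⟨k, hk⟩ := hne
  have hnotin : ∀ i x, x ∉ B i → f x ∉ H i '' B i := by
    rintro i x hx ⟨y, hy, hyx⟩
    rw [hfout i x hx] at hyx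
    exact hx ((hHb i).1 hyx ▸ hy)
  refine ⟨f, hfc, ?_, fun x hx => hfout 0 x hx, fun x y => ⟨fun hxy => ?_, ?_⟩⟩
  · intro z
    by_cases hz : ∀ i, z ∈ H i '' B i
    · exact ⟨k, huniq _ _ (hK k hk) hz⟩
    · push Not at hz
      obtain ⟨i, hi⟩ := hz
      obtain ⟨x, rfl⟩ := (hHb i).2 z
      exact ⟨x, hfout i x fun h => hi ⟨x, h, rfl⟩⟩
  · by_contra! hcon
    obtain ⟨hne, hcon⟩ := hcon
    by_cases hx : x ∈ ⋂ i, B i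
    · have hy := hcon hx
      rw [mem_iInter] at hy; push Not at hy
      obtain ⟨i, hi⟩ := hy
      exact hnotin i y hi (hxy ▸ hK x hx i)
    · rw [mem_iInter] at hx; push Not at hx
      obtain ⟨i, hi⟩ := hx
      by_cases hy : y ∈ B i
      · exact hnotin i x hi (hxy ▸ hfin i y hy)
      · rw [hfout i x hi, hfout i y hy] at hxy
        exact hne ((hHb i).1 hxy)
  · rintro (rfl | ⟨hx, hy⟩)
    · rfl
    · exact huniq _ _ (hK x hx) (hK y hy)

lemma quotient_homeo [Nontrivial E] (B : ℕ → Set E) (hB : ∀ i, Nonempty (B i ≃ₜ closedBall (0:E) 1))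
    (hBi : ∀ i, B (i + 1) ⊆ interior (B i)) (hne : (⋂ i, B i).Nonempty) :
    Nonempty (Quotient (shrinkSetoid (⋂ i, B i)) ≃ₜ E) := by
  obtain ⟨f, hf, hsurj, hout, hker⟩ := collapse_exists B hB hBi hne
  have hB0 : IsCompact (B 0) := by
    have : CompactSpace (closedBall (0:E) 1) := isCompact_iff_compactSpace.1 (isCompact_closedBall 0 1)
    have : CompactSpace (B 0) := (hB 0).some.symm.compactSpace
    exact isCompact_iff_compactSpace.2 this
  have hprop : IsProperMap f := by
    rw [isProperMap_iff_tendsto_cocompact]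
    refine ⟨hf, tendsto_id.congr' ?_⟩
    filter_upwards [hB0.compl_mem_cocompact] with x hx using (hout x hx).symm
  have hq : IsQuotientMap f := hprop.isClosedMap.isQuotientMap hf hsurj
  have : shrinkSetoid (⋂ i, B i) = Setoid.ker f := by
    ext x y
    exact (hker x y).symm
  rw [this]
  exact ⟨IsQuotientMap.homeomorph (f := ⟨f, hf⟩) hq⟩

end Squeeze

section Shrink
variable {E : Type*} [NormedAddCommGroup E] [InnerProductSpace ℝ E] [FiniteDimensional ℝ E]

lemma cont_inv {Φ : E → E} {T S : Set E} (hT : IsCompact T) (hΦ : ContinuousOn Φ T) (hi : InjOn Φ T)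
    {g : E → E} (hg : ∀ x ∈ S, g x ∈ T) (hc : ContinuousOn (fun x => Φ (g x)) S) :
    ContinuousOn g S := by
  have : CompactSpace T := isCompact_iff_compactSpace.1 hT
  have hemb : IsClosedEmbedding (T.domRestrict Φ) :=
    (continuousOn_iff_continuous_domRestrict.1 hΦ).isClosedEmbedding (injOn_iff_injective.1 hi)
  rw [continuousOn_iff_continuous_domRestrict] at hc ⊢
  let g' : S → T := fun x => ⟨g x, hg x x.2⟩
  have : Continuous g' := by
    rw [hemb.isInducing.continuous_iff]
    exact hc
  exact continuous_subtype_val.comp this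

lemma shrink_ball {K U : Set E} {x₀ y : E} {R : ℝ} (hR : 0 < R) (hKQ : K ⊆ ball x₀ R)
    (hU : IsOpen U) (hKU : K ⊆ U) {Φ : E → E} (hΦ : ContinuousOn Φ (closedBall x₀ R))
    (hy : ∀ x ∈ closedBall x₀ R, Φ x = y ↔ x ∈ K) (hi : InjOn Φ (closedBall x₀ R \ K))
    (hop : ∀ V, IsOpen V → K ⊆ V → Φ '' (V ∩ closedBall x₀ R) ∈ 𝓝 y) :
    ∃ B : Set E, Nonempty (B ≃ₜ closedBall (0:E) 1) ∧ K ⊆ interior B ∧ B ⊆ U := by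
  classical
  let Q := closedBall x₀ R
  have hQc : IsCompact Q := isCompact_closedBall x₀ R
  obtain ⟨ε, hε, hεs⟩ := Metric.nhds_basis_ball.mem_iff.1 (hop U hU hKU)
  obtain ⟨δ, hδ, rfl⟩ : ∃ δ, 0 < δ ∧ 2 * δ = ε := ⟨ε / 2, by positivity, by ring⟩
  have hsame : ∀ x ∈ Q, ∀ x' ∈ Q, Φ x = Φ x' → x = x' ∨ (x ∈ K ∧ x' ∈ K) := by
    intro x hx x' hx' h
    by_cases hxK : x ∈ K
    · right
      refine ⟨hxK, (hy x' hx').1 ?_⟩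
      rw [← h]; exact (hy x hx).2 hxK
    · left
      refine hi ⟨hx, hxK⟩ ⟨hx', fun hK => hxK ((hy x hx).1 ?_)⟩ h
      rw [h]; exact (hy x' hx').2 hK
  let a : ℝ → ℝ := fun t => min 1 (2 * δ / (t + δ))
  have ha0 : ∀ t, 0 ≤ t → 0 < a t := fun t ht => lt_min one_pos (by positivity)
  have hat : ∀ t, 0 ≤ t → a t * t = min t (2 * δ * t / (t + δ)) := fun t ht => by
    simp only [a]
    rw [min_mul_of_nonneg _ _ ht, one_mul, div_mul_eq_mul_div]
  have hmono : ∀ t t', 0 ≤ t → t < t' → a t * t < a t' * t' := by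
    intro t t' ht htt
    rw [hat t ht, hat t' (ht.trans htt.le)]
    refine min_lt_min htt ?_
    have : 0 < t' := ht.trans_lt htt
    rw [div_lt_div_iff₀ (by positivity) (by positivity)]
    nlinarith [mul_pos hδ hδ]
  let k : E → E := fun z => y + a ‖z - y‖ • (z - y)
  have hkn : ∀ z, ‖k z - y‖ = a ‖z - y‖ * ‖z - y‖ := fun z => by
    simp only [k, add_sub_cancel_left]
    rw [norm_smul, Real.norm_of_nonneg (ha0 _ (norm_nonneg _)).le]
  have hkc : Continuous k := by
    have : Continuous fun z : E => 2 * δ / (‖z - y‖ + δ) :=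
      continuous_const.div (by fun_prop) fun z => by positivity
    have h2 : Continuous fun z : E => a ‖z - y‖ := continuous_const.min this
    exact continuous_const.add (h2.smul (by fun_prop))
  have hki : Function.Injective k := by
    intro z z' h
    have hn : ‖z - y‖ = ‖z' - y‖ := by
      have h1 := hkn z
      rw [h, hkn z'] at h1
      rcases lt_trichotomy ‖z - y‖ ‖z' - y‖ with hlt | heq | hlt
      · have := hmono _ _ (norm_nonneg _) hlt; linarith
      · exact heq
      · have := hmono _ _ (norm_nonneg _) hlt; linarith
    simp only [k, hn] at h
    have := smul_right_injective E (ha0 ‖z' - y‖ (norm_nonneg _)).ne' (add_left_cancel h)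
    exact sub_left_injective this
  have hkid : ∀ z, ‖z - y‖ ≤ δ → k z = z := by
    intro z hz
    have : a ‖z - y‖ = 1 := by
      refine min_eq_left ?_
      rw [le_div_iff₀ (by positivity)]; linarith
    simp [k, this]
  have hkδ : ∀ z, δ ≤ ‖z - y‖ → δ ≤ ‖k z - y‖ := by
    intro z hz
    rw [hkn, hat _ (norm_nonneg _)]
    refine le_min hz ?_
    rw [le_div_iff₀ (by positivity)]
    nlinarith
  have hk2 : ∀ z, k z ∈ ball y (2 * δ) := by
    intro z
    rw [mem_ball, dist_eq_norm, hkn, hat _ (norm_nonneg _)]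
    refine (min_le_right _ _).trans_lt ?_
    rw [div_lt_iff₀ (by positivity)]
    nlinarith [mul_pos hδ hδ]
  have hex : ∀ x, ∃ x', x' ∈ U ∩ Q ∧ Φ x' = k (Φ x) := fun x => by
    obtain ⟨x', hx', h⟩ := hεs (hk2 (Φ x))
    exact ⟨x', hx', h⟩
  choose θ hθ1 hθ2 using hex
  let g : E → E := fun x => if ‖Φ x - y‖ ≤ δ then x else θ x
  have hg : ∀ x ∈ Q, g x ∈ U ∩ Q ∧ Φ (g x) = k (Φ x) := by
    intro x hx
    by_cases h : ‖Φ x - y‖ ≤ δ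
    · have : g x = x := if_pos h
      rw [this, hkid _ h]
      refine ⟨⟨?_, hx⟩, rfl⟩
      have h2 := hθ2 x
      rw [hkid _ h] at h2
      rcases hsame _ (hθ1 x).2 x hx h2 with h3 | h3
      · rw [← h3]; exact (hθ1 x).1
      · exact hKU h3.2
    · have : g x = θ x := if_neg h
      rw [this]
      exact ⟨hθ1 x, hθ2 x⟩
  have hnc : ContinuousOn (fun x => ‖Φ x - y‖) Q := (hΦ.sub continuousOn_const).norm
  have hcl1 : IsClosed (Q ∩ (fun x => ‖Φ x - y‖) ⁻¹' Iic δ) :=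
    hnc.preimage_isClosed_of_isClosed hQc.isClosed isClosed_Iic
  have hcl2 : IsClosed (Q ∩ (fun x => ‖Φ x - y‖) ⁻¹' Ici δ) :=
    hnc.preimage_isClosed_of_isClosed hQc.isClosed isClosed_Ici
  have hgc : ContinuousOn g Q := by
    have h1 : ContinuousOn g (Q ∩ (fun x => ‖Φ x - y‖) ⁻¹' Iic δ) :=
      continuousOn_id.congr fun x hx => if_pos hx.2
    have h2 : ContinuousOn g (Q ∩ (fun x => ‖Φ x - y‖) ⁻¹' Ici δ) := by
      refine cont_inv (T := Q ∩ (fun x => ‖Φ x - y‖) ⁻¹' Ici δ) (Φ := Φ)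
        (hQc.of_isClosed_subset hcl2 inter_subset_left) (hΦ.mono inter_subset_left) ?_ ?_ ?_
      · intro x hx x' hx' h
        rcases hsame x hx.1 x' hx'.1 h with h3 | h3
        · exact h3
        · exfalso
          have h4 := (hy x hx.1).2 h3.1
          have h5 : δ ≤ ‖Φ x - y‖ := hx.2
          rw [h4, sub_self, norm_zero] at h5
          linarith
      · intro x hx
        refine ⟨(hg x hx.1).1.2, ?_⟩
        change δ ≤ ‖Φ (g x) - y‖
        rw [(hg x hx.1).2]
        exact hkδ _ hx.2
      · refine (hkc.comp_continuousOn (hΦ.mono inter_subset_left)).congr fun x hx => (hg x hx.1).2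
    have := h1.union_of_isClosed h2 hcl1 hcl2
    refine this.mono fun x hx => ?_
    rcases le_total ‖Φ x - y‖ δ with h | h
    · exact Or.inl ⟨hx, h⟩
    · exact Or.inr ⟨hx, h⟩
  have hgi : InjOn g Q := by
    intro x hx x' hx' h
    have h1 : Φ x = Φ x' := hki (by rw [← (hg x hx).2, ← (hg x' hx').2, h])
    rcases hsame x hx x' hx' h1 with h3 | h3
    · exact h3
    · have e1 : g x = x := if_pos (by rw [(hy x hx).2 h3.1]; simpa using hδ.le)
      have e2 : g x' = x' := if_pos (by rw [(hy x' hx').2 h3.2]; simpa using hδ.le)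
      rw [← e1, ← e2, h]
  refine ⟨g '' Q, ?_, ?_, ?_⟩
  · -- homeomorphic to the unit ball
    let γ : closedBall (0:E) 1 → E := fun z => g (x₀ + R • (z : E))
    have hmaps : ∀ z : closedBall (0:E) 1, x₀ + R • (z : E) ∈ Q := by
      rintro ⟨z, hz⟩
      have hz1 : ‖z‖ ≤ 1 := by simpa using hz
      simp only [Q, mem_closedBall, dist_eq_norm, add_sub_cancel_left]
      rw [norm_smul, Real.norm_of_nonneg hR.le]
      exact mul_le_of_le_one_right hR.le hz1
    have hγc : Continuous γ := hgc.comp_continuous (by fun_prop) hmaps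
    have hγi : Function.Injective γ := by
      intro z z' h
      have := hgi (hmaps z) (hmaps z') h
      exact Subtype.ext (smul_right_injective E hR.ne' (add_left_cancel this))
    have hcs : CompactSpace (closedBall (0:E) 1) := isCompact_iff_compactSpace.1 (isCompact_closedBall 0 1)
    have hγr : range γ = g '' Q := by
      apply Subset.antisymm
      · rintro _ ⟨z, rfl⟩; exact ⟨_, hmaps z, rfl⟩
      · rintro _ ⟨x, hx, rfl⟩
        have hz : R⁻¹ • (x - x₀) ∈ closedBall (0:E) 1 := by
          have : ‖x - x₀‖ ≤ R := by simpa [Q, dist_eq_norm] using hx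
          simp only [mem_closedBall, dist_zero_right]
          rw [norm_smul, norm_inv, Real.norm_of_nonneg hR.le, inv_mul_le_iff₀ hR]; linarith
        refine ⟨⟨_, hz⟩, ?_⟩
        simp only [γ]
        rw [smul_smul, mul_inv_cancel₀ hR.ne', one_smul, add_sub_cancel]
    rw [← hγr]
    exact ⟨((hγc.isClosedEmbedding hγi).isEmbedding.toHomeomorph).symm⟩
  · intro x hx
    have hxQ : ∀ z ∈ ball x₀ R, z ∈ Q := fun z hz => ball_subset_closedBall hz
    have ho : IsOpen (ball x₀ R ∩ (fun x => ‖Φ x - y‖) ⁻¹' Iio δ) :=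
      (hnc.mono hxQ).isOpen_inter_preimage isOpen_ball isOpen_Iio
    refine interior_maximal ?_ ho ⟨hKQ hx, ?_⟩
    · rintro z ⟨hz, hz2⟩
      exact ⟨z, hxQ z hz, if_pos (le_of_lt hz2)⟩
    · simp only [mem_preimage, mem_Iio]
      rw [(hy x (hxQ x (hKQ hx))).2 hx]; simpa using hδ
  · rintro _ ⟨x, hx, rfl⟩
    exact (hg x hx).1.1

end Shrink

section Local
variable {E : Type*} [NormedAddCommGroup E] [InnerProductSpace ℝ E] [FiniteDimensional ℝ E]

lemma slide_homeo [Nontrivial E] : ∃ (h : E ≃ₜ E) (w q : E), w ≠ 0 ∧ ‖w‖ < 1 ∧ q ≠ 0 ∧ ‖q‖ ≤ 1 ∧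
    h 0 = w ∧ h q = 0 ∧ (∀ v, ‖v‖ = 1 → h v = v) ∧ ∀ v, ‖v‖ ≤ 1 → ‖h v‖ ≤ 1 := by
  obtain ⟨e, he⟩ := exists_norm_eq E (zero_le_one : (0:ℝ) ≤ 1)
  have he0 : e ≠ 0 := by rintro rfl; simp at he
  have hw : ‖(1/2:ℝ) • e‖ = 1/2 := by rw [norm_smul, he]; norm_num
  have hq : ‖(-(1/3):ℝ) • e‖ = 1/3 := by rw [norm_smul, he]; norm_num
  obtain ⟨h, hh⟩ := pert_homeo (fun v : E => (1 - ‖v‖) • ((1/2:ℝ) • e)) (1/2)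
    (by rw [← NNReal.coe_lt_coe]; norm_num) (by
      refine LipschitzWith.of_dist_le_mul fun x y => ?_
      rw [dist_eq_norm, ← sub_smul, norm_smul, hw, dist_eq_norm]
      have := abs_norm_sub_norm_le y x
      rw [norm_sub_rev y x] at this
      have h2 : (1 - ‖x‖ - (1 - ‖y‖)) = ‖y‖ - ‖x‖ := by ring
      rw [h2, Real.norm_eq_abs]
      push_cast
      linarith)
  refine ⟨h, (1/2:ℝ) • e, (-(1/3):ℝ) • e, smul_ne_zero (by norm_num) he0, by rw [hw]; norm_num,
    smul_ne_zero (by norm_num) he0, by rw [hq]; norm_num, by simp [hh], ?_, ?_, ?_⟩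
  · rw [hh, hq, smul_smul, ← add_smul]; norm_num
  · intro v hv; rw [hh, hv]; simp
  · intro v hv
    rw [hh]
    refine (norm_add_le _ _).trans ?_
    rw [norm_smul, hw, Real.norm_of_nonneg (by linarith)]
    linarith

lemma gmap [Nontrivial E] {K M : Set E} (hKc : IsClosed K) (hKne : K.Nonempty) (hM : IsCompact M) (hKM : K ⊆ M)
    {φ : E → E} (hφ : ContinuousOn φ M) (hφ1 : ∀ x ∈ M, ‖φ x‖ ≤ 1)
    (hφs : ∀ z, ‖z‖ ≤ 1 → ∃ x ∈ M, φ x = z) (hφ0 : ∀ x ∈ M, φ x = 0 ↔ x ∈ K)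
    (hφi : InjOn φ (M \ K)) (hMo : IsOpen {x | x ∈ M ∧ ‖φ x‖ < 1}) :
    ∃ (g : E → E) (x0 c y0 : E), x0 ∉ K ∧ c ∈ K ∧ g x0 = c ∧ (∀ x, x ≠ x0 → g x ∉ K) ∧
      (∀ x, x ≠ x0 → ContinuousAt g x) ∧ (∀ x, x ∉ M → g x = x) ∧ x0 ∈ M ∧
      (∀ x x', x ≠ x0 → x' ≠ x0 → g x = g x' → x = x' ∨ (x ∈ K ∧ x' ∈ K)) ∧
      (∀ x ∈ K, g x = y0) ∧ y0 ∉ K ∧ ∀ V, IsOpen V → K ⊆ V → g '' V ∈ 𝓝 y0 := by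
  classical
  obtain ⟨h, w, q, hw0, hw1, hq0, hq1, hh0, hhq, hhs, hhb⟩ := slide_homeo (E := E)
  obtain ⟨c, hc⟩ := hKne
  choose! ψ hψM hψ using hφs
  have hψφ : ∀ u ∈ M, u ∉ K → ψ (φ u) = u := by
    intro u hu huK
    have h1 := hφ1 u hu
    refine hφi ⟨hψM _ h1, fun hK => huK ?_⟩ ⟨hu, huK⟩ (hψ _ h1)
    rw [← hφ0 u hu, ← hψ _ h1]
    exact (hφ0 _ (hψM _ h1)).2 hK
  have hψK : ∀ z, ‖z‖ ≤ 1 → z ≠ 0 → ψ z ∉ K := by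
    intro z hz hz0 hK
    apply hz0
    rw [← hψ z hz]
    exact (hφ0 _ (hψM z hz)).2 hK
  have hψc : ContinuousOn ψ (closedBall 0 1 \ {0}) := by
    intro z0 hz0
    have hz0' : z0 ≠ 0 := by simpa using hz0.2
    have hp := norm_pos_iff.2 hz0'
    have hcl : IsCompact (M ∩ φ ⁻¹' {u | ‖z0‖ / 2 ≤ ‖u‖}) := by
      refine hM.of_isClosed_subset ?_ inter_subset_left
      exact hφ.preimage_isClosed_of_isClosed hM.isClosed (isClosed_le continuous_const continuous_norm)
    have key : ContinuousOn ψ (closedBall 0 1 ∩ {u : E | ‖z0‖ / 2 < ‖u‖}) := by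
      refine cont_inv hcl (hφ.mono inter_subset_left) (hφi.mono ?_) ?_ ?_
      · rintro x ⟨hx, hx2⟩
        refine ⟨hx, fun hK => ?_⟩
        rw [mem_preimage, (hφ0 x hx).2 hK] at hx2
        simp only [mem_ofPred_eq, norm_zero] at hx2
        linarith
      · rintro z ⟨hz, hz2⟩
        have hz1 : ‖z‖ ≤ 1 := by simpa using hz
        refine ⟨hψM z hz1, ?_⟩
        rw [mem_preimage, hψ z hz1]
        simp only [mem_ofPred_eq] at hz2 ⊢
        exact hz2.le
      · refine continuousOn_id.congr ?_
        rintro z ⟨hz, hz2⟩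
        exact hψ z (by simpa using hz)
    have hO : {u : E | ‖z0‖ / 2 < ‖u‖} ∈ 𝓝 z0 :=
      (isOpen_lt continuous_const continuous_norm).mem_nhds (by simp only [mem_ofPred_eq]; linarith)
    have h1 := key z0 ⟨hz0.1, by simp only [mem_ofPred_eq]; linarith⟩
    exact ((continuousWithinAt_inter hO).1 h1).mono sdiff_subset
  have hV : ∀ V, IsOpen V → K ⊆ V → ∃ ε > 0, ∀ x ∈ M, ‖φ x‖ < ε → x ∈ V := by
    intro V hVo hKV
    have hcp : IsCompact (M \ V) := hM.diff hVo
    rcases (M \ V).eq_empty_or_nonempty with he | hne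
    · refine ⟨1, one_pos, fun x hx _ => ?_⟩
      by_contra hxV
      have : x ∈ M \ V := ⟨hx, hxV⟩
      rw [he] at this; exact this
    · obtain ⟨x1, hx1, hmin⟩ := hcp.exists_isMinOn hne (hφ.mono sdiff_subset).norm
      refine ⟨‖φ x1‖, norm_pos_iff.2 fun h0 => hx1.2 (hKV ((hφ0 x1 hx1.1).1 h0)), fun x hx hlt => ?_⟩
      by_contra hxV
      have := hmin (show x ∈ M \ V from ⟨hx, hxV⟩)
      simp only [mem_ofPred_eq] at this
      linarith
  have hMn : ∀ x ∈ M, ‖φ x‖ < 1 → M ∈ 𝓝 x := fun x hx hx1 =>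
    mem_of_superset (hMo.mem_nhds ⟨hx, hx1⟩) fun z hz => hz.1
  let x0 := ψ q
  have hx0M : x0 ∈ M := hψM q hq1
  have hx0K : x0 ∉ K := hψK q hq1 hq0
  have hx0φ : φ x0 = q := hψ q hq1
  have hne0 : ∀ x ∈ M, x ≠ x0 → h (φ x) ≠ 0 := by
    intro x hx hxne h0
    have h1 : φ x = q := h.injective (h0.trans hhq.symm)
    refine hxne (hφi ⟨hx, fun hK => hq0 ?_⟩ ⟨hx0M, hx0K⟩ (h1.trans hx0φ.symm))
    rw [← h1]; exact (hφ0 x hx).2 hK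
  let g : E → E := fun x => if x ∈ M then (if x = x0 then c else ψ (h (φ x))) else x
  have hg0 : g x0 = c := by simp [g, hx0M]
  have hgM : ∀ x ∈ M, x ≠ x0 → g x = ψ (h (φ x)) := fun x hx hne => by simp [g, hx, hne]
  have hgn : ∀ x, x ∉ M → g x = x := fun x hx => by simp [g, hx]
  have hhM : ∀ x ∈ M, ‖h (φ x)‖ ≤ 1 := fun x hx => hhb _ (hφ1 x hx)
  have hgMM : ∀ x ∈ M, x ≠ x0 → g x ∈ M := fun x hx hne => by
    rw [hgM x hx hne]; exact hψM _ (hhM x hx)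
  have hφg : ∀ x ∈ M, x ≠ x0 → φ (g x) = h (φ x) := fun x hx hne => by
    rw [hgM x hx hne]; exact hψ _ (hhM x hx)
  have hneK : ∀ x ∈ K, x ≠ x0 := fun x hx he => hx0K (he ▸ hx)
  refine ⟨g, x0, c, ψ w, hx0K, hc, hg0, ?_, ?_, hgn, hx0M, ?_, ?_, hψK w hw1.le hw0, ?_⟩
  · intro x hx
    by_cases hxM : x ∈ M
    · rw [hgM x hxM hx]; exact hψK _ (hhM x hxM) (hne0 x hxM hx)
    · rw [hgn x hxM]; exact fun hK => hxM (hKM hK)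
  · intro x hx
    by_cases hxM : x ∈ M
    · have hne : {x0}ᶜ ∈ 𝓝 x := isOpen_compl_singleton.mem_nhds hx
      have hcM : ContinuousWithinAt g M x := by
        have h1 : ContinuousOn (fun x => ψ (h (φ x))) (M ∩ {x0}ᶜ) := by
          refine hψc.comp (h.continuous.comp_continuousOn (hφ.mono inter_subset_left)) ?_
          rintro z ⟨hz, hz0⟩
          exact ⟨by simpa using hhM z hz, by simpa using hne0 z hz hz0⟩
        have h2 : ContinuousOn g (M ∩ {x0}ᶜ) := h1.congr fun z hz => hgM z hz.1 hz.2
        exact (continuousWithinAt_inter hne).1 (h2 x ⟨hxM, hx⟩)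
      rcases (hφ1 x hxM).lt_or_eq with hlt | heq
      · exact hcM.continuousAt (hMn x hxM hlt)
      · have hgx : g x = x := by
          rw [hgM x hxM hx, hhs _ heq]
          refine hψφ x hxM fun hK => ?_
          rw [(hφ0 x hxM).2 hK] at heq
          simp at heq
        have hcc : ContinuousWithinAt g Mᶜ x :=
          continuousWithinAt_id.congr (fun z hz => hgn z hz) hgx
        have := hcM.union hcc
        rwa [union_compl_self, continuousWithinAt_univ] at this
    · have : g =ᶠ[𝓝 x] id := by
        filter_upwards [hM.isClosed.isOpen_compl.mem_nhds hxM] with z hz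
        exact hgn z hz
      exact continuousAt_id.congr this.symm
  · intro x x' hx hx' hxx
    by_cases hxM : x ∈ M
    · by_cases hxM' : x' ∈ M
      · have h1 : φ x = φ x' := h.injective (by rw [← hφg x hxM hx, ← hφg x' hxM' hx', hxx])
        by_cases hK : x ∈ K
        · refine Or.inr ⟨hK, (hφ0 x' hxM').1 ?_⟩
          rw [← h1]; exact (hφ0 x hxM).2 hK
        · left
          refine hφi ⟨hxM, hK⟩ ⟨hxM', fun hK' => hK ((hφ0 x hxM).1 ?_)⟩ h1
          rw [h1]; exact (hφ0 x' hxM').2 hK'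
      · exfalso; apply hxM'
        rw [← hgn x' hxM', ← hxx]; exact hgMM x hxM hx
    · by_cases hxM' : x' ∈ M
      · exfalso; apply hxM
        rw [← hgn x hxM, hxx]; exact hgMM x' hxM' hx'
      · left; rwa [hgn x hxM, hgn x' hxM'] at hxx
  · intro x hx
    rw [hgM x (hKM hx) (hneK x hx), (hφ0 x (hKM hx)).2 hx, hh0]
  · intro V hVo hKV
    obtain ⟨ε, hε, hεV⟩ := hV V hVo hKV
    have hyM := hψM w hw1.le
    have hyn : M ∈ 𝓝 (ψ w) := hMn _ hyM (by rw [hψ w hw1.le]; exact hw1)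
    have hca : ContinuousAt (fun z => h.symm (φ z)) (ψ w) :=
      h.symm.continuous.continuousAt.comp (hφ.continuousAt hyn)
    have hv0 : h.symm (φ (ψ w)) = 0 := by rw [hψ w hw1.le, ← hh0]; simp
    have hnb : ball (0:E) (min ε ‖q‖) ∈ 𝓝 (h.symm (φ (ψ w))) := by
      rw [hv0]; exact ball_mem_nhds _ (lt_min hε (norm_pos_iff.2 hq0))
    filter_upwards [hyn, hca hnb, hKc.isOpen_compl.mem_nhds (hψK w hw1.le hw0)] with z hzM hzb hzK
    have hzb' : ‖h.symm (φ z)‖ < min ε ‖q‖ := by simpa using hzb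
    set v := h.symm (φ z) with hv
    have hv1 : ‖v‖ ≤ 1 := (hzb'.trans_le (min_le_right _ _)).le.trans hq1
    have hxM := hψM v hv1
    have hne : ψ v ≠ x0 := by
      intro he
      have : v = q := by rw [← hψ v hv1, he, hx0φ]
      have h3 := hzb'.trans_le (min_le_right _ _)
      rw [this] at h3; exact lt_irrefl _ h3
    refine ⟨ψ v, hεV _ hxM (by rw [hψ v hv1]; exact hzb'.trans_le (min_le_left _ _)), ?_⟩
    rw [hgM _ hxM hne, hψ v hv1, hv, h.apply_symm_apply]
    exact hψφ z hzM hzK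

open EuclideanGeometry in
lemma inv_step {K M U : Set E} (hKc : IsCompact K) (hM : IsCompact M) (hUo : IsOpen U) (hKU : K ⊆ U)
    {g : E → E} {x0 c y0 : E} (hx0 : x0 ∉ K) (hc : c ∈ K) (hg0 : g x0 = c)
    (hgK : ∀ x, x ≠ x0 → g x ∉ K) (hgc : ∀ x, x ≠ x0 → ContinuousAt g x)
    (hgM : ∀ x, x ∉ M → g x = x)
    (hgi : ∀ x x', x ≠ x0 → x' ≠ x0 → g x = g x' → x = x' ∨ (x ∈ K ∧ x' ∈ K))
    (hgy : ∀ x ∈ K, g x = y0) (hy0 : y0 ∉ K) (hgo : ∀ V, IsOpen V → K ⊆ V → g '' V ∈ 𝓝 y0) :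
    ∃ B : Set E, Nonempty (B ≃ₜ closedBall (0:E) 1) ∧ K ⊆ interior B ∧ B ⊆ U := by
  let ι : E → E := inversion x0 1
  let j : E → E := inversion c 1
  have hιι : ∀ x, ι (ι x) = x := inversion_inversion x0 one_ne_zero
  have hjj : ∀ x, j (j x) = x := inversion_inversion c one_ne_zero
  have hιx : ∀ x, ι x = x0 ↔ x = x0 := fun x => inversion_eq_center one_ne_zero
  have hjx : ∀ x, j x = c ↔ x = c := fun x => inversion_eq_center one_ne_zero
  have hιi : Function.Injective ι := inversion_injective x0 one_ne_zero
  have hji : Function.Injective j := inversion_injective c one_ne_zero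
  have hιc : ∀ x, x ≠ x0 → ContinuousAt ι x := fun x hx =>
    continuousAt_const.inversion continuousAt_const continuousAt_id hx
  have hjc : ∀ x, x ≠ c → ContinuousAt j x := fun x hx =>
    continuousAt_const.inversion continuousAt_const continuousAt_id hx
  have hιon : ContinuousOn ι {x0}ᶜ := fun x hx => (hιc x hx).continuousWithinAt
  have hneK : ∀ x ∈ K, x ≠ x0 := fun x hx he => hx0 (he ▸ hx)
  let Φ : E → E := fun x => j (g (ι x))
  have hΦ : Continuous Φ := by
    rw [continuous_iff_continuousAt]
    intro x
    rcases eq_or_ne x x0 with rfl | hx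
    · rw [continuousAt_iff_punctured_nhds]
      have hΦx : Φ x = c := by
        simp only [Φ]
        rw [(hιx x).2 rfl, hg0]; exact (hjx c).2 rfl
      rw [hΦx]
      have hcob := tendsto_inversion_nhdsNE_center_cobounded (c := x) (R := 1) one_ne_zero
      have hev : ∀ᶠ z in 𝓝[≠] x, ι z ∉ M := hcob hM.isBounded
      have ht : Tendsto (fun z => j (ι z)) (𝓝[≠] x) (𝓝 c) := by
        rw [tendsto_iff_dist_tendsto_zero]
        have h1 : ∀ z, dist (j (ι z)) c = (dist (ι z) c)⁻¹ := fun z => by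
          simp only [j]; rw [dist_inversion_center]; simp
        simp only [h1]
        exact tendsto_inv_atTop_zero.comp ((tendsto_dist_right_atTop_iff c).2 hcob)
      refine ht.congr' ?_
      filter_upwards [hev] with z hz
      simp only [Φ]; rw [hgM _ hz]
    · have h1 : ι x ≠ x0 := fun h => hx ((hιx x).1 h)
      have h2 : ContinuousAt (fun x => g (ι x)) x := ContinuousAt.comp (hgc _ h1) (hιc x hx)
      have h3 : g (ι x) ≠ c := fun h => hgK _ h1 (h ▸ hc)
      exact ContinuousAt.comp (f := fun x => g (ι x)) (hjc _ h3) h2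
  have hK' : IsCompact (ι ⁻¹' K) := by
    have : ι ⁻¹' K = ι '' K := by
      ext x; constructor
      · intro hx; exact ⟨ι x, hx, hιι x⟩
      · rintro ⟨z, hz, rfl⟩; rw [mem_preimage, hιι]; exact hz
    rw [this]
    exact hKc.image_of_continuousOn (hιon.mono hneK)
  obtain ⟨R, hR, hKR⟩ := hK'.isBounded.subset_ball_lt 0 x0
  have hyc : y0 ≠ c := fun h => hy0 (h ▸ hc)
  obtain ⟨B', ⟨e⟩, hKB, hBU⟩ := shrink_ball (K := ι ⁻¹' K) (U := {x0}ᶜ ∩ ι ⁻¹' U) (y := j y0) (Φ := Φ) hR hKR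
    (hιon.isOpen_inter_preimage isOpen_compl_singleton hUo)
    (fun x hx => ⟨fun h => hneK _ hx ((hιx x).2 h), hKU hx⟩) hΦ.continuousOn
    (by
      intro x _
      constructor
      · intro h
        have h1 : g (ι x) = y0 := hji h
        rcases eq_or_ne (ι x) x0 with h2 | h2
        · rw [h2, hg0] at h1; exact absurd h1.symm hyc
        · rcases hgi (ι x) c h2 (hneK c hc) (h1.trans (hgy c hc).symm) with h3 | h3
          · rw [mem_preimage, h3]; exact hc
          · exact h3.1
      · intro hx
        simp only [Φ]; rw [hgy _ hx])
    (by
      rintro x ⟨_, hx⟩ x' ⟨_, hx'⟩ h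
      have h1 : g (ι x) = g (ι x') := hji h
      rcases eq_or_ne (ι x) x0 with h2 | h2 <;> rcases eq_or_ne (ι x') x0 with h3 | h3
      · exact hιi (h2.trans h3.symm)
      · rw [h2, hg0] at h1; exact absurd (h1 ▸ hc) (hgK _ h3)
      · rw [h3, hg0] at h1; exact absurd (h1.symm ▸ hc) (hgK _ h2)
      · rcases hgi _ _ h2 h3 h1 with h4 | h4
        · exact hιi h4
        · exact absurd h4.1 hx)
    (by
      intro V hV hKV
      have hV1 : IsOpen ({x0}ᶜ ∩ ι ⁻¹' (V ∩ ball x0 R)) :=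
        hιon.isOpen_inter_preimage isOpen_compl_singleton (hV.inter isOpen_ball)
      have hm : ∀ x ∈ K, ι x ∈ ι ⁻¹' K := fun x hx => by rw [mem_preimage, hιι]; exact hx
      have h1 := hgo _ hV1 (fun x hx => ⟨hneK x hx, hKV (hm x hx), hKR (hm x hx)⟩)
      have h2 : ContinuousAt j (j y0) := hjc _ (fun h => hyc ((hjx y0).1 h))
      have h3 := h2.preimage_mem_nhds (by rw [hjj]; exact h1)
      filter_upwards [h3] with z hz
      obtain ⟨x, hx, hxz⟩ := hz
      refine ⟨ι x, ⟨hx.2.1, ball_subset_closedBall hx.2.2⟩, ?_⟩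
      simp only [Φ]
      rw [hιι, hxz, hjj])
  have hcs : CompactSpace (closedBall (0:E) 1) := isCompact_iff_compactSpace.1 (isCompact_closedBall 0 1)
  have hcs' : CompactSpace B' := e.symm.compactSpace
  have hB0 : ∀ x ∈ B', x ≠ x0 := fun x hx => (hBU hx).1
  let γ : B' → E := fun x => ι x
  have hγc : Continuous γ := (hιon.mono hB0).comp_continuous continuous_subtype_val fun x => x.2
  have hγi : Function.Injective γ := fun a b hab => Subtype.ext (hιi hab)
  have hγr : range γ = ι '' B' := by
    ext z; simp [γ]
  refine ⟨ι '' B', ?_, ?_, ?_⟩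
  · rw [← hγr]
    exact ⟨((hγc.isClosedEmbedding hγi).isEmbedding.toHomeomorph).symm.trans e⟩
  · have ho : IsOpen ({x0}ᶜ ∩ ι ⁻¹' (interior B')) :=
      hιon.isOpen_inter_preimage isOpen_compl_singleton isOpen_interior
    refine Subset.trans ?_ (interior_maximal ?_ ho)
    · intro x hx
      refine ⟨hneK x hx, hKB ?_⟩
      rw [mem_preimage, hιι]; exact hx
    · rintro x ⟨_, hx⟩
      exact ⟨ι x, interior_subset hx, hιι x⟩
  · rintro _ ⟨x, hx, rfl⟩
    exact (hBU hx).2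

end Local

section Final
variable {E : Type*} [NormedAddCommGroup E] [InnerProductSpace ℝ E] [FiniteDimensional ℝ E]

lemma proj_eq (K : Set E) (x y : E) :
    (Quotient.mk (shrinkSetoid K) x = Quotient.mk (shrinkSetoid K) y) ↔ x = y ∨ (x ∈ K ∧ y ∈ K) :=
  Quotient.eq

lemma proj_proper {K : Set E} (hKc : IsCompact K) : IsProperMap (Quotient.mk (shrinkSetoid K)) := by
  rw [isProperMap_iff_isClosedMap_and_compact_fibers]
  have hc : Continuous (Quotient.mk (shrinkSetoid K)) := continuous_quotient_mk'
  refine ⟨hc, ?_, ?_⟩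
  · intro C hC
    have hq : IsQuotientMap (Quotient.mk (shrinkSetoid K)) := isQuotientMap_quotient_mk'
    rw [← hq.isClosed_preimage]
    by_cases hne : (C ∩ K).Nonempty
    · obtain ⟨k, hkC, hkK⟩ := hne
      have : Quotient.mk (shrinkSetoid K) ⁻¹' (Quotient.mk (shrinkSetoid K) '' C) = C ∪ K := by
        ext x; constructor
        · rintro ⟨z, hz, hzx⟩
          rcases (proj_eq K _ _).1 hzx with rfl | h
          · exact Or.inl hz
          · exact Or.inr h.2
        · rintro (hx | hx)
          · exact ⟨x, hx, rfl⟩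
          · exact ⟨k, hkC, (proj_eq K _ _).2 (Or.inr ⟨hkK, hx⟩)⟩
      rw [this]; exact hC.union hKc.isClosed
    · have : Quotient.mk (shrinkSetoid K) ⁻¹' (Quotient.mk (shrinkSetoid K) '' C) = C := by
        ext x; constructor
        · rintro ⟨z, hz, hzx⟩
          rcases (proj_eq K _ _).1 hzx with rfl | h
          · exact hz
          · exact absurd ⟨z, hz, h.1⟩ hne
        · intro hx; exact ⟨x, hx, rfl⟩
      rw [this]; exact hC
  · intro y
    obtain ⟨y, rfl⟩ := Quotient.exists_rep y
    by_cases hy : y ∈ K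
    · have : Quotient.mk (shrinkSetoid K) ⁻¹' {Quotient.mk (shrinkSetoid K) y} = K := by
        ext x
        rw [mem_preimage, mem_singleton_iff, proj_eq]
        constructor
        · rintro (rfl | h)
          · exact hy
          · exact h.1
        · intro h; exact Or.inr ⟨h, hy⟩
      rw [this]; exact hKc
    · have : Quotient.mk (shrinkSetoid K) ⁻¹' {Quotient.mk (shrinkSetoid K) y} = {y} := by
        ext x
        rw [mem_preimage, mem_singleton_iff, proj_eq]
        constructor
        · rintro (rfl | h)
          · rfl
          · exact absurd h.2 hy
        · intro h; exact Or.inl h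
      rw [this]; exact isCompact_singleton

lemma chart_map {K : Set E} (hKc : IsCompact K) {k0 : E} (hk0 : k0 ∈ K)
    {V : Set (Quotient (shrinkSetoid K))} (hV : IsOpen V) (hp : Quotient.mk (shrinkSetoid K) k0 ∈ V)
    {W : Set E} (hW : IsOpen W) (e : V ≃ₜ W) :
    ∃ (M : Set E) (φ : E → E), IsCompact M ∧ K ⊆ M ∧ ContinuousOn φ M ∧ (∀ x ∈ M, ‖φ x‖ ≤ 1) ∧
    (∀ z, ‖z‖ ≤ 1 → ∃ x ∈ M, φ x = z) ∧ (∀ x ∈ M, φ x = 0 ↔ x ∈ K) ∧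
    InjOn φ (M \ K) ∧ IsOpen {x | x ∈ M ∧ ‖φ x‖ < 1} := by
  classical
  let π : E → Quotient (shrinkSetoid K) := Quotient.mk (shrinkSetoid K)
  have hπ : IsProperMap π := proj_proper hKc
  have hπeq : ∀ x y, π x = π y ↔ x = y ∨ (x ∈ K ∧ y ∈ K) := proj_eq K
  let a : E := e ⟨π k0, hp⟩
  obtain ⟨r, hr, hrW⟩ := Metric.nhds_basis_closedBall.mem_iff.1 (hW.mem_nhds (e ⟨π k0, hp⟩).2)
  let φ : E → E := fun x => if h : π x ∈ V then r⁻¹ • ((e ⟨π x, h⟩ : E) - a) else 0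
  have hφe : ∀ x (h : π x ∈ V), φ x = r⁻¹ • ((e ⟨π x, h⟩ : E) - a) := fun x h => dif_pos h
  have hφc : ContinuousOn φ (π ⁻¹' V) := by
    rw [continuousOn_iff_continuous_domRestrict]
    have : (π ⁻¹' V).domRestrict φ = fun x : (π ⁻¹' V) => r⁻¹ • ((e ⟨π x, x.2⟩ : E) - a) := by
      ext x; exact hφe x x.2
    rw [this]
    have h1 : Continuous fun x : (π ⁻¹' V) => (⟨π x, x.2⟩ : V) :=
      (hπ.continuous.comp continuous_subtype_val).subtype_mk _
    have h2 : Continuous fun x : (π ⁻¹' V) => ((e ⟨π x, x.2⟩ : W) : E) :=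
      continuous_subtype_val.comp (e.continuous.comp h1)
    exact (h2.sub continuous_const).const_smul _
  have hzW : ∀ z : closedBall (0:E) 1, a + r • (z : E) ∈ W := by
    rintro ⟨z, hz⟩
    have hz1 : ‖z‖ ≤ 1 := by simpa using hz
    apply hrW
    simp only [mem_closedBall, dist_eq_norm, a, add_sub_cancel_left]
    rw [norm_smul, Real.norm_of_nonneg hr.le]
    exact mul_le_of_le_one_right hr.le hz1
  let τ : closedBall (0:E) 1 → Quotient (shrinkSetoid K) := fun z => e.symm ⟨a + r • (z : E), hzW z⟩
  have hτc : Continuous τ := by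
    have h1 : Continuous fun z : closedBall (0:E) 1 => (⟨a + r • (z : E), hzW z⟩ : W) :=
      (continuous_const.add (continuous_subtype_val.const_smul r)).subtype_mk _
    exact continuous_subtype_val.comp (e.symm.continuous.comp h1)
  have hcs : CompactSpace (closedBall (0:E) 1) := isCompact_iff_compactSpace.1 (isCompact_closedBall 0 1)
  have hφτ : ∀ x z, π x = τ z → π x ∈ V ∧ φ x = z := by
    intro x z hx
    have hm : π x ∈ V := by rw [hx]; exact (e.symm _).2
    refine ⟨hm, ?_⟩
    rw [hφe x hm]
    have : (⟨π x, hm⟩ : V) = e.symm ⟨a + r • (z : E), hzW z⟩ := Subtype.ext hx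
    rw [this, e.apply_symm_apply, add_sub_cancel_left, smul_smul, inv_mul_cancel₀ hr.ne', one_smul]
  have hMeq : {x | π x ∈ V ∧ ‖φ x‖ ≤ 1} = π ⁻¹' (range τ) := by
    ext x; constructor
    · rintro ⟨hx, hx1⟩
      refine ⟨⟨φ x, by simpa using hx1⟩, ?_⟩
      have h1 : a + r • φ x = e ⟨π x, hx⟩ := by
        rw [hφe x hx, smul_smul, mul_inv_cancel₀ hr.ne', one_smul, add_sub_cancel]
      have h2 : (⟨a + r • φ x, hzW ⟨φ x, by simpa using hx1⟩⟩ : W) = e ⟨π x, hx⟩ := Subtype.ext h1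
      simp only [τ]
      rw [h2, e.symm_apply_apply]
    · rintro ⟨z, hz⟩
      obtain ⟨h1, h2⟩ := hφτ x z hz.symm
      refine ⟨h1, ?_⟩
      rw [h2]; exact mem_closedBall_zero_iff.1 z.2
  have hsame : ∀ x x', π x ∈ V → π x' ∈ V → φ x = φ x' → π x = π x' := by
    intro x x' hx hx' h
    rw [hφe x hx, hφe x' hx'] at h
    have h1 := sub_left_injective (smul_right_injective E (inv_ne_zero hr.ne') h)
    have h2 := e.injective (Subtype.ext h1)
    exact congrArg Subtype.val h2
  have hφk : φ k0 = 0 := by rw [hφe k0 hp]; simp [a]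
  have hKV : ∀ x ∈ K, π x = π k0 := fun x hx => (hπeq _ _).2 (Or.inr ⟨hx, hk0⟩)
  have hφK : ∀ x ∈ K, φ x = 0 := by
    intro x hx
    have h1 : π x ∈ V := by rw [hKV x hx]; exact hp
    rw [← hφk, hφe x h1, hφe k0 hp]
    have : (⟨π x, h1⟩ : V) = ⟨π k0, hp⟩ := Subtype.ext (hKV x hx)
    rw [this]
  refine ⟨{x | π x ∈ V ∧ ‖φ x‖ ≤ 1}, φ, ?_, ?_, hφc.mono fun x hx => hx.1, fun x hx => hx.2, ?_, ?_, ?_, ?_⟩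
  · rw [hMeq]; exact hπ.isCompact_preimage (isCompact_range hτc)
  · intro x hx
    refine ⟨by rw [hKV x hx]; exact hp, ?_⟩
    rw [hφK x hx]; simp
  · intro z hz
    obtain ⟨x, hx⟩ := Quotient.exists_rep (τ ⟨z, by simpa using hz⟩)
    obtain ⟨h1, h2⟩ := hφτ x _ hx
    exact ⟨x, ⟨h1, by rw [h2]; exact hz⟩, h2⟩
  · intro x hx
    refine ⟨fun h => ?_, hφK x⟩
    rcases (hπeq _ _).1 (hsame x k0 hx.1 hp (h.trans hφk.symm)) with rfl | h
    · exact hk0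
    · exact h.1
  · intro x hx x' hx' h
    rcases (hπeq _ _).1 (hsame x x' hx.1.1 hx'.1.1 h) with h | h
    · exact h
    · exact absurd h.1 hx.2
  · have : {x | (x ∈ {x | π x ∈ V ∧ ‖φ x‖ ≤ 1}) ∧ ‖φ x‖ < 1} = π ⁻¹' V ∩ φ ⁻¹' (ball 0 1) := by
      ext x
      simp only [mem_ofPred_eq, mem_inter_iff, mem_preimage, mem_ball, dist_zero_right]
      constructor
      · rintro ⟨⟨h1, _⟩, h2⟩; exact ⟨h1, h2⟩
      · rintro ⟨h1, h2⟩; exact ⟨⟨h1, h2.le⟩, h2⟩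
    rw [this]
    exact hφc.isOpen_inter_preimage (hV.preimage hπ.continuous) isOpen_ball

lemma cellular_of {K : Set E} (hKc : IsCompact K)
    (H : ∀ U, IsOpen U → K ⊆ U → ∃ B : Set E, Nonempty (B ≃ₜ closedBall (0:E) 1) ∧ K ⊆ interior B ∧ B ⊆ U) :
    ∃ B : ℕ → Set E, (∀ i, Nonempty (B i ≃ₜ closedBall (0:E) 1)) ∧
      (∀ i, B (i + 1) ⊆ interior (B i)) ∧ K = ⋂ i, B i := by
  have hth : ∀ i : ℕ, K ⊆ thickening (1 / ((i:ℝ) + 1)) K := fun i => self_subset_thickening (by positivity) K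
  let T := {B : Set E // Nonempty (B ≃ₜ closedBall (0:E) 1) ∧ K ⊆ interior B}
  have hstep : ∀ (i : ℕ) (B : T), ∃ B' : T, (B' : Set E) ⊆ interior B ∩ thickening (1 / ((i:ℝ) + 1)) K := by
    intro i B
    obtain ⟨B', h1, h2, h3⟩ := H (interior B ∩ thickening (1 / ((i:ℝ) + 1)) K)
      (isOpen_interior.inter isOpen_thickening) (subset_inter B.2.2 (hth i))
    exact ⟨⟨B', h1, h2⟩, h3⟩
  choose F hF using hstep
  obtain ⟨B0, h1, h2, _⟩ := H univ isOpen_univ (subset_univ _)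
  let B : ℕ → T := fun i => Nat.rec ⟨B0, h1, h2⟩ (fun i b => F i b) i
  have hB : ∀ i, B (i + 1) = F i (B i) := fun i => rfl
  refine ⟨fun i => (B i).1, fun i => (B i).2.1, fun i => ?_, ?_⟩
  · simp only [hB]
    exact (hF i (B i)).trans inter_subset_left
  · apply Subset.antisymm
    · exact subset_iInter fun i => (B i).2.2.trans interior_subset
    · intro x hx
      rw [← hKc.isClosed.closure_eq, closure_eq_iInter_thickening]
      simp only [mem_iInter] at hx ⊢
      intro δ hδ
      obtain ⟨i, hi⟩ := exists_nat_one_div_lt hδ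
      have := hx (i + 1)
      rw [hB] at this
      exact thickening_mono hi.le K (hF i (B i) this).2

lemma main_local [Nontrivial E] {K : Set E} (hKne : K.Nonempty) (hKc : IsCompact K)
    (H : ∀ q : Quotient (shrinkSetoid K), ∃ V : Set (Quotient (shrinkSetoid K)),
          IsOpen V ∧ q ∈ V ∧ ∃ W : Set E, IsOpen W ∧ Nonempty (↥V ≃ₜ ↥W)) :
    ∃ B : ℕ → Set E, (∀ i, Nonempty (B i ≃ₜ closedBall (0:E) 1)) ∧
      (∀ i, B (i + 1) ⊆ interior (B i)) ∧ K = ⋂ i, B i := by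
  obtain ⟨k0, hk0⟩ := hKne
  obtain ⟨V, hV, hp, W, hW, ⟨e⟩⟩ := H (Quotient.mk (shrinkSetoid K) k0)
  obtain ⟨M, φ, hM, hKM, h1, h2, h3, h4, h5, h6⟩ := chart_map hKc hk0 hV hp hW e
  obtain ⟨g, x0, c, y0, a1, a2, a3, a4, a5, a6, _, a7, a8, a9, a10⟩ :=
    gmap hKc.isClosed ⟨k0, hk0⟩ hM hKM h1 h2 h3 h4 h5 h6
  exact cellular_of hKc fun U hU hKU => inv_step hKc hM hU hKU a1 a2 a3 a4 a5 a6 a7 a8 a9 a10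

end Final

end Helpers

/-- For a nonempty compact `K ⊆ ℝⁿ`, the quotient `ℝⁿ/K` is homeomorphic to `ℝⁿ` iff
it is a topological `n`-manifold iff `K` is cellular. -/
theorem stmt_13 (n : ℕ) (hn : 1 ≤ n) (K : Set (EuclideanSpace ℝ (Fin n)))
    (hKne : K.Nonempty) (hKc : IsCompact K) :
    List.TFAE
      [ Nonempty (Quotient (shrinkSetoid K) ≃ₜ EuclideanSpace ℝ (Fin n)),
        ∀ q : Quotient (shrinkSetoid K), ∃ V : Set (Quotient (shrinkSetoid K)),
          IsOpen V ∧ q ∈ V ∧ ∃ W : Set (EuclideanSpace ℝ (Fin n)),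
            IsOpen W ∧ Nonempty (↥V ≃ₜ ↥W),
        IsCellularIn (EuclideanSpace ℝ (Fin n)) n K ] := by
  have hnt : Nontrivial (EuclideanSpace ℝ (Fin n)) := by
    have : Nonempty (Fin n) := ⟨⟨0, hn⟩⟩
    infer_instance
  tfae_have 1 → 2 := by
    rintro ⟨e⟩ q
    exact ⟨Set.univ, isOpen_univ, Set.mem_univ _, Set.univ, isOpen_univ,
      ⟨(Homeomorph.Set.univ _).trans (e.trans (Homeomorph.Set.univ _).symm)⟩⟩
  tfae_have 2 → 3 := fun H => main_local hKne hKc H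
  tfae_have 3 → 1 := by
    rintro ⟨B, hB, hBi, rfl⟩
    exact quotient_homeo B hB hBi hKne
  tfae_finish
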